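/- arXiv:1906.02176 — 2 statements merged into one kernel-verified Lean document; each statement's English description precedes it below -/
import Mathlib

section
/- Let A be a real n×m matrix with singular values σ₁ ≥ σ₂ ≥ ⋯ ≥ 0. Let r ≥ 1 be a target rank and p ≥ 4 an oversampling parameter with k := r + p ≤ min{m,n}. Let Ω be an m×k random matrix whose entries are independent standard Gaussian random variables. Then with probability at least 1 − 6e^{−p}, the orthogonal projection P onto the column space of AΩ satisfies ‖A − P A‖₂ ≤ (1 + 17√(1 + r/p)) σ_{r+1} + (8√k/(p+1)) (∑_{j>r} σ_j²)^{1/2}, where ‖·‖₂ denotes the spectral (operator) norm. -/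
open MeasureTheory ProbabilityTheory Matrix

/-- The spectral (operator) norm of a real matrix, i.e. the operator norm of the induced
linear map between Euclidean spaces. -/
noncomputable def spectralNorm' {n m : ℕ} (A : Matrix (Fin n) (Fin m) ℝ) : ℝ :=
  ‖LinearMap.toContinuousLinearMap (Matrix.toEuclideanLin A)‖

/-- The standard Gaussian measure on `ι → ℝ`. -/
noncomputable abbrev piGaussian (ι : Type*) [Fintype ι] : Measure (ι → ℝ) :=
  Measure.pi fun _ => gaussianReal 0 1

section
variable {ι κ : Type*} [Fintype ι] [Fintype κ]

instance isGaussian_piGaussian : IsGaussian (piGaussian ι) := by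
  classical
  have : piGaussian ι = (stdGaussian (EuclideanSpace ℝ ι)).map
      (EuclideanSpace.equiv ι ℝ).toContinuousLinearMap := by
    rw [← map_pi_eq_stdGaussian, Measure.map_map (by fun_prop) (by fun_prop)]
    exact Measure.map_id.symm
  rw [this]
  infer_instance

theorem measurePreserving_mulVec_piGaussian [DecidableEq κ] (B : Matrix κ ι ℝ) (hB : B * Bᵀ = 1) :
    MeasurePreserving (fun x => B *ᵥ x) (piGaussian ι) (piGaussian κ) := by
  have hm : Measurable fun x : ι → ℝ => B *ᵥ x := by fun_prop
  refine ⟨hm, ?_⟩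
  have key : ((piGaussian ι).map (fun x => B *ᵥ x)).map (WithLp.toLp 2)
      = (piGaussian κ).map (WithLp.toLp 2) := by
    rw [map_pi_eq_stdGaussian]
    have : IsFiniteMeasure (((piGaussian ι).map (fun x => B *ᵥ x)).map (WithLp.toLp 2)) := by
      infer_instance
    refine Measure.ext_of_charFun ?_
    ext t
    have h1 := charFun_stdGaussian (E := EuclideanSpace ℝ ι) (WithLp.toLp 2 (Bᵀ *ᵥ t.ofLp))
    rw [← map_pi_eq_stdGaussian] at h1
    rw [charFun_stdGaussian]
    rw [charFun_apply, Measure.map_map (by fun_prop) hm, integral_map (by fun_prop) (by fun_prop)]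
    rw [charFun_apply, integral_map (by fun_prop) (by fun_prop)] at h1
    have hn : ‖WithLp.toLp 2 (Bᵀ *ᵥ t.ofLp)‖ ^ 2 = ‖t‖ ^ 2 := by
      rw [EuclideanSpace.real_norm_sq_eq, EuclideanSpace.real_norm_sq_eq]
      have : (Bᵀ *ᵥ t.ofLp) ⬝ᵥ (Bᵀ *ᵥ t.ofLp) = t.ofLp ⬝ᵥ t.ofLp := by
        rw [dotProduct_mulVec, vecMul_transpose, mulVec_mulVec, hB, one_mulVec]
      simpa [dotProduct, sq] using this
    rw [← Complex.ofReal_pow, hn] at h1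
    rw [← Complex.ofReal_pow, ← h1]
    refine integral_congr_ae (.of_forall fun x => ?_)
    simp only [EuclideanSpace.inner_eq_star_dotProduct, Function.comp_def, star_trivial]
    rw [dotProduct_mulVec, ← mulVec_transpose]
  have := congrArg (Measure.map WithLp.ofLp) key
  rw [Measure.map_map (by fun_prop) (by fun_prop),
    Measure.map_map (by fun_prop) (by fun_prop),
    Measure.map_map (by fun_prop) (by fun_prop)] at this
  simpa only [Function.comp_def, WithLp.ofLp_toLp, Measure.map_id'] using this

theorem measurePreserving_update_piGaussian [DecidableEq ι] (i : ι) :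
    MeasurePreserving (fun q : (ι → ℝ) × ℝ => Function.update q.1 i q.2)
      ((piGaussian ι).prod (gaussianReal 0 1)) (piGaussian ι) := by
  have hm : Measurable (fun q : (ι → ℝ) × ℝ => Function.update q.1 i q.2) := by
    refine measurable_pi_lambda _ fun j => ?_
    rcases eq_or_ne j i with rfl | h
    · simpa using measurable_snd
    · simp only [Function.update_of_ne h]; fun_prop
  refine ⟨hm, ?_⟩
  symm
  refine Measure.pi_eq fun s hs => ?_
  rw [Measure.map_apply hm (MeasurableSet.univ_pi hs)]
  have : (fun q : (ι → ℝ) × ℝ => Function.update q.1 i q.2) ⁻¹' (Set.univ.pi s)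
      = (Set.univ.pi (Function.update s i Set.univ)) ×ˢ (s i) := by
    ext q
    simp only [Set.mem_preimage, Set.mem_univ_pi, Set.mem_prod]
    constructor
    · intro h
      refine ⟨fun j => ?_, by simpa using h i⟩
      rcases eq_or_ne j i with rfl | hj
      · simp
      · simpa [Function.update_of_ne hj] using h j
    · rintro ⟨h, h'⟩ j
      rcases eq_or_ne j i with rfl | hj
      · simpa
      · simpa [Function.update_of_ne hj] using h j
  rw [this, Measure.prod_prod, Measure.pi_pi, ← Finset.mul_prod_erase _ _ (Finset.mem_univ i),
    ← Finset.mul_prod_erase _ _ (Finset.mem_univ i)]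
  simp only [Function.update_self, measure_univ, one_mul]
  rw [mul_comm]
  congr 1
  refine Finset.prod_congr rfl fun j hj => ?_
  rw [Function.update_of_ne (Finset.ne_of_mem_erase hj)]

theorem integrable_piGaussian_of_le {f : (ι → ℝ) → ℝ} (hf : Measurable f) (C : ℝ) (n : ℕ)
    (h : ∀ x, |f x| ≤ C * ‖x‖ ^ n) : Integrable f (piGaussian ι) := by
  have h1 : MemLp id (n : ENNReal) (piGaussian ι) :=
    IsGaussian.memLp_id _ _ (ENNReal.natCast_ne_top n)
  have h2 : Integrable (fun x : ι → ℝ => ‖x‖ ^ n) (piGaussian ι) := by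
    rcases Nat.eq_zero_or_pos n with rfl | hn
    · simp
    · simpa using h1.integrable_norm_pow hn.ne'
  exact (h2.const_mul C).mono' hf.aestronglyMeasurable (.of_forall h)

theorem integral_id_mul_gaussianReal {f f' : ℝ → ℝ} (hd : ∀ x, HasDerivAt f (f' x) x)
    (hf : Integrable f (gaussianReal 0 1)) (hxf : Integrable (fun x => x * f x) (gaussianReal 0 1))
    (hf' : Integrable f' (gaussianReal 0 1)) :
    ∫ x, x * f x ∂(gaussianReal 0 1) = ∫ x, f' x ∂(gaussianReal 0 1) := by
  have conv : ∀ g : ℝ → ℝ, Integrable g (gaussianReal 0 1) →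
      Integrable (fun x => gaussianPDFReal 0 1 x * g x) := by
    intro g hg
    rw [gaussianReal_of_var_ne_zero _ one_ne_zero] at hg
    rw [integrable_withDensity_iff_integrable_smul₀' (by fun_prop) (by simp [gaussianPDF])] at hg
    simpa [gaussianPDF, gaussianPDFReal_nonneg] using hg
  have hpdf : ∀ x, HasDerivAt (gaussianPDFReal 0 1) (-x * gaussianPDFReal 0 1 x) x := by
    intro x
    rw [gaussianPDFReal_def]
    have : HasDerivAt (fun x : ℝ => -(x - 0) ^ 2 / (2 * ((1 : NNReal) : ℝ))) (-x) x :=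
      ((((hasDerivAt_id' x).sub_const 0).pow 2).neg.div_const _).congr_deriv (by simp; ring)
    exact (this.exp.const_mul _).congr_deriv (by ring)
  have h0 := integral_eq_zero_of_hasDerivAt_of_integrable
    (f := fun x => gaussianPDFReal 0 1 x * f x)
    (f' := fun x => gaussianPDFReal 0 1 x * f' x - gaussianPDFReal 0 1 x * (x * f x))
    (fun x => ((hpdf x).mul (hd x)).congr_deriv (by ring)) ((conv _ hf').sub (conv _ hxf))
    (conv _ hf)
  rw [integral_sub (conv _ hf') (conv _ hxf)] at h0
  simp only [integral_gaussianReal_eq_integral_smul one_ne_zero, smul_eq_mul]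
  linarith

theorem integral_coord_mul_piGaussian [DecidableEq ι] (i : ι) {F F' : (ι → ℝ) → ℝ}
    (hd : ∀ x t, HasDerivAt (fun t => F (Function.update x i t)) (F' (Function.update x i t)) t)
    (hF : Integrable F (piGaussian ι)) (hxF : Integrable (fun x => x i * F x) (piGaussian ι))
    (hF' : Integrable F' (piGaussian ι)) :
    ∫ x, x i * F x ∂(piGaussian ι) = ∫ x, F' x ∂(piGaussian ι) := by
  have mp := measurePreserving_update_piGaussian i
  have e : ∀ {g : (ι → ℝ) → ℝ}, Integrable g (piGaussian ι) →
    Integrable (fun q : (ι → ℝ) × ℝ => g (Function.update q.1 i q.2))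
      ((piGaussian ι).prod (gaussianReal 0 1)) := fun hg => mp.integrable_comp_of_integrable hg
  have e2 : ∀ {g : (ι → ℝ) → ℝ}, Integrable g (piGaussian ι) →
      ∫ x, g x ∂(piGaussian ι)
        = ∫ x, ∫ t, g (Function.update x i t) ∂(gaussianReal 0 1) ∂(piGaussian ι) := by
    intro g hg
    rw [← integral_prod _ (e hg), ← integral_map mp.measurable.aemeasurable
      (by rw [mp.map_eq]; exact hg.aestronglyMeasurable), mp.map_eq]
  rw [e2 hxF, e2 hF']
  refine integral_congr_ae ?_
  filter_upwards [(e hF).prod_right_ae, (e hxF).prod_right_ae, (e hF').prod_right_ae]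
    with x h1 h2 h3
  simp only [Function.update_self] at h2 ⊢
  exact integral_id_mul_gaussianReal (hd x) h1 h2 h3

theorem hasDerivAt_sum_mul_sq_update [DecidableEq ι] (c x : ι → ℝ) (i : ι) (t : ℝ) :
    HasDerivAt (fun t => ∑ j, c j * Function.update x i t j ^ 2)
      (2 * c i * Function.update x i t i) t := by
  have h := HasDerivAt.fun_sum (u := Finset.univ) fun j _ =>
    (((hasDerivAt_pi.1 (hasDerivAt_update x i t) j).pow 2).const_mul (c j))
  refine h.congr_deriv ?_
  rw [Finset.sum_eq_single i]
  · simp; ring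
  · intro j _ hj; simp [hj]
  · simp

theorem abs_sum_mul_sq_le (c : ι → ℝ) (x : ι → ℝ) :
    |∑ j, c j * x j ^ 2| ≤ (∑ j, |c j|) * ‖x‖ ^ 2 := by
  rw [Finset.sum_mul]
  refine (Finset.abs_sum_le_sum_abs _ _).trans (Finset.sum_le_sum fun j _ => ?_)
  rw [abs_mul, abs_pow]
  gcongr
  exact norm_le_pi_norm x j

theorem integrable_coord_pow_mul_pow (c : ι → ℝ) (i : ι) (b a : ℕ) :
    Integrable (fun x => x i ^ b * (∑ j, c j * x j ^ 2) ^ a) (piGaussian ι) := by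
  refine integrable_piGaussian_of_le (by fun_prop) ((∑ j, |c j|) ^ a) (b + 2 * a) fun x => ?_
  rw [abs_mul, abs_pow, abs_pow]
  calc |x i| ^ b * |∑ j, c j * x j ^ 2| ^ a
      ≤ ‖x‖ ^ b * ((∑ j, |c j|) * ‖x‖ ^ 2) ^ a := by
        gcongr
        · exact norm_le_pi_norm x i
        · exact abs_sum_mul_sq_le c x
    _ = _ := by ring

theorem integrable_sum_mul_sq_pow (c : ι → ℝ) (a : ℕ) :
    Integrable (fun x => (∑ j, c j * x j ^ 2) ^ a) (piGaussian ι) := by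
  refine integrable_piGaussian_of_le (by fun_prop) ((∑ j, |c j|) ^ a) (2 * a) fun x => ?_
  rw [abs_pow, pow_mul, ← mul_pow]
  gcongr
  exact abs_sum_mul_sq_le c x

theorem integral_sum_mul_sq_pow_succ_le (c : ι → ℝ) (hc : ∀ i, 0 ≤ c i) (s : ℝ)
    (hs : ∀ i, c i ≤ s) (a : ℕ) :
    ∫ x, (∑ j, c j * x j ^ 2) ^ (a + 1) ∂(piGaussian ι)
      ≤ (∑ j, c j + 2 * a * s) * ∫ x, (∑ j, c j * x j ^ 2) ^ a ∂(piGaussian ι) := by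
  classical
  have hi : ∀ i, ∫ x, x i * (x i * (∑ j, c j * x j ^ 2) ^ a) ∂(piGaussian ι)
      = ∫ x, ((∑ j, c j * x j ^ 2) ^ a
        + 2 * a * c i * (x i ^ 2 * (∑ j, c j * x j ^ 2) ^ (a - 1))) ∂(piGaussian ι) := by
    intro i
    refine integral_coord_mul_piGaussian i (fun x t => ?_) ?_ ?_ ?_
    · have h1 := (hasDerivAt_sum_mul_sq_update c x i t).pow a
      have h2 : HasDerivAt (fun t => Function.update x i t i) 1 t := by
        simpa using hasDerivAt_id' t
      refine (h2.mul h1).congr_deriv ?_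
      simp only [Pi.pow_apply]
      ring
    · simpa using integrable_coord_pow_mul_pow c i 1 a
    · simpa [← mul_assoc, ← sq] using integrable_coord_pow_mul_pow c i 2 a
    · exact (integrable_sum_mul_sq_pow c a).add
        ((integrable_coord_pow_mul_pow c i 2 (a - 1)).const_mul _)
  have e1 : ∫ x, (∑ j, c j * x j ^ 2) ^ (a + 1) ∂(piGaussian ι)
      = ∑ i, c i * ∫ x, x i * (x i * (∑ j, c j * x j ^ 2) ^ a) ∂(piGaussian ι) := by
    simp_rw [← integral_const_mul]
    rw [← integral_finsetSum]
    · refine integral_congr_ae (.of_forall fun x => ?_)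
      simp only
      rw [pow_succ', Finset.sum_mul]
      exact Finset.sum_congr rfl fun i _ => by ring
    · intro i _
      simpa [← mul_assoc, ← sq] using (integrable_coord_pow_mul_pow c i 2 a).const_mul (c i)
  rw [e1]
  simp_rw [hi, ← integral_const_mul]
  rw [← integral_finsetSum]
  · refine integral_mono ?_ ((integrable_sum_mul_sq_pow c a).const_mul _) fun x => ?_
    · exact integrable_finsetSum _ fun i _ => (((integrable_sum_mul_sq_pow c a).add
        ((integrable_coord_pow_mul_pow c i 2 (a - 1)).const_mul _)).const_mul _)
    · simp only
      set y := ∑ j, c j * x j ^ 2 with hy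
      have hy0 : 0 ≤ y := Finset.sum_nonneg fun j _ => mul_nonneg (hc j) (sq_nonneg _)
      rcases Nat.eq_zero_or_pos a with rfl | ha
      · simp
      · calc ∑ i, c i * (y ^ a + 2 * a * c i * (x i ^ 2 * y ^ (a - 1)))
            ≤ ∑ i, (c i * y ^ a + 2 * a * s * y ^ (a - 1) * (c i * x i ^ 2)) := by
              refine Finset.sum_le_sum fun i _ => ?_
              have : 0 ≤ 2 * a * y ^ (a - 1) * (c i * x i ^ 2) * (s - c i) := by
                have := hc i
                have := sub_nonneg.2 (hs i)
                positivity
              nlinarith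
          _ = (∑ j, c j + 2 * a * s) * y ^ a := by
              rw [Finset.sum_add_distrib, ← Finset.sum_mul, ← Finset.mul_sum, ← hy, add_mul,
                mul_assoc _ (y ^ (a - 1)), pow_sub_one_mul ha.ne']
  · exact fun i _ => (((integrable_sum_mul_sq_pow c a).add
        ((integrable_coord_pow_mul_pow c i 2 (a - 1)).const_mul _)).const_mul _)

theorem lintegral_sum_mul_sq_pow_le (c : ι → ℝ) (hc : ∀ i, 0 ≤ c i) (s : ℝ) (hs0 : 0 ≤ s)
    (hs : ∀ i, c i ≤ s) (a : ℕ) :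
    ∫⁻ x, ENNReal.ofReal (∑ j, c j * x j ^ 2) ^ a ∂(piGaussian ι)
      ≤ ENNReal.ofReal (∏ l ∈ Finset.range a, (∑ j, c j + 2 * l * s)) := by
  have hy0 : ∀ x : ι → ℝ, 0 ≤ ∑ j, c j * x j ^ 2 := fun x =>
    Finset.sum_nonneg fun j _ => mul_nonneg (hc j) (sq_nonneg _)
  have : ∫⁻ x, ENNReal.ofReal (∑ j, c j * x j ^ 2) ^ a ∂(piGaussian ι)
      = ENNReal.ofReal (∫ x, (∑ j, c j * x j ^ 2) ^ a ∂(piGaussian ι)) := by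
    rw [ofReal_integral_eq_lintegral_ofReal (integrable_sum_mul_sq_pow c a)
      (.of_forall fun x => pow_nonneg (hy0 x) a)]
    exact lintegral_congr fun x => (ENNReal.ofReal_pow (hy0 x) a).symm
  rw [this]
  refine ENNReal.ofReal_le_ofReal ?_
  clear this
  induction a with
  | zero => simp
  | succ a ih =>
    refine (integral_sum_mul_sq_pow_succ_le c hc s hs a).trans ?_
    rw [Finset.prod_range_succ, mul_comm]
    have : 0 ≤ ∑ j, c j := Finset.sum_nonneg fun j _ => hc j
    gcongr

theorem integrable_coord_pow_mul_inv_pow {ε : ℝ} (hε : 0 < ε) (i : ι) (b a : ℕ) :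
    Integrable (fun x => x i ^ b * ((∑ j, x j ^ 2 + ε)⁻¹) ^ a) (piGaussian ι) := by
  refine integrable_piGaussian_of_le (by fun_prop) ((ε⁻¹) ^ a) b fun x => ?_
  have h0 : 0 ≤ ∑ j, x j ^ 2 := Finset.sum_nonneg fun j _ => sq_nonneg _
  rw [abs_mul, abs_pow, abs_pow, mul_comm, abs_of_nonneg (by positivity)]
  gcongr
  · linarith
  · exact norm_le_pi_norm x i

theorem integrable_inv_sum_sq_add_pow {ε : ℝ} (hε : 0 < ε) (a : ℕ) :
    Integrable (fun x => ((∑ j, x j ^ 2 + ε)⁻¹) ^ a) (piGaussian ι) := by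
  refine integrable_piGaussian_of_le (by fun_prop) ((ε⁻¹) ^ a) 0 fun x => ?_
  have h0 : 0 ≤ ∑ j, x j ^ 2 := Finset.sum_nonneg fun j _ => sq_nonneg _
  rw [abs_pow, abs_of_nonneg (by positivity), pow_zero, mul_one]
  gcongr
  linarith

theorem integral_inv_sum_sq_add_pow_succ_le {ε : ℝ} (hε : 0 < ε) (a : ℕ) :
    ((Fintype.card ι : ℝ) - 2 * (a + 1)) *
        ∫ x, ((∑ j, x j ^ 2 + ε)⁻¹) ^ (a + 1) ∂(piGaussian ι)
      ≤ ∫ x, ((∑ j, x j ^ 2 + ε)⁻¹) ^ a ∂(piGaussian ι) := by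
  classical
  have hi : ∀ i, ∫ x, x i * (x i * ((∑ j, x j ^ 2 + ε)⁻¹) ^ (a + 1)) ∂(piGaussian ι)
      = ∫ x, (((∑ j, x j ^ 2 + ε)⁻¹) ^ (a + 1)
        - 2 * (a + 1) * (x i ^ 2 * ((∑ j, x j ^ 2 + ε)⁻¹) ^ (a + 2))) ∂(piGaussian ι) := by
    intro i
    refine integral_coord_mul_piGaussian i (fun x t => ?_) ?_ ?_ ?_
    · have h0 : 0 ≤ ∑ j, Function.update x i t j ^ 2 := Finset.sum_nonneg fun j _ => sq_nonneg _
      have h1 := hasDerivAt_sum_mul_sq_update 1 x i t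
      simp only [Pi.one_apply, one_mul] at h1
      have h1' := ((h1.add_const ε).inv (by positivity)).pow (a + 1)
      have h2 : HasDerivAt (fun t => Function.update x i t i) 1 t := by
        simpa using hasDerivAt_id' t
      refine (h2.mul h1').congr_deriv ?_
      simp only [Pi.pow_apply, Pi.inv_apply, Nat.add_sub_cancel]
      rw [div_eq_mul_inv, ← inv_pow]
      push_cast
      ring
    · simpa using integrable_coord_pow_mul_inv_pow hε i 1 (a + 1)
    · simpa [← mul_assoc, ← sq] using integrable_coord_pow_mul_inv_pow hε i 2 (a + 1)
    · exact (integrable_inv_sum_sq_add_pow hε (a + 1)).sub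
        ((integrable_coord_pow_mul_inv_pow hε i 2 (a + 2)).const_mul _)
  have e1 : ∑ i, ∫ x, x i * (x i * ((∑ j, x j ^ 2 + ε)⁻¹) ^ (a + 1)) ∂(piGaussian ι)
      ≤ ∫ x, ((∑ j, x j ^ 2 + ε)⁻¹) ^ a ∂(piGaussian ι) := by
    have hint : ∀ i ∈ Finset.univ, Integrable
        (fun x : ι → ℝ => x i * (x i * ((∑ j, x j ^ 2 + ε)⁻¹) ^ (a + 1))) (piGaussian ι) := by
      intro i _
      simpa [← mul_assoc, ← sq] using integrable_coord_pow_mul_inv_pow hε i 2 (a + 1)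
    rw [← integral_finsetSum _ hint]
    refine integral_mono (integrable_finsetSum _ hint) (integrable_inv_sum_sq_add_pow hε a)
      fun x => ?_
    have h0 : 0 ≤ ∑ j, x j ^ 2 := Finset.sum_nonneg fun j _ => sq_nonneg _
    simp only [← mul_assoc, ← sq, ← Finset.sum_mul, pow_succ]
    have : (∑ j, x j ^ 2) * (∑ j, x j ^ 2 + ε)⁻¹ ≤ 1 := by
      rw [← div_eq_mul_inv, div_le_one (by positivity)]; linarith
    calc _ = (∑ j, x j ^ 2) * (∑ j, x j ^ 2 + ε)⁻¹ * ((∑ j, x j ^ 2 + ε)⁻¹) ^ a := by ring_nf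
      _ ≤ 1 * ((∑ j, x j ^ 2 + ε)⁻¹) ^ a := by gcongr
      _ = _ := one_mul _
  refine le_trans ?_ e1
  simp_rw [hi]
  have hint : ∀ i ∈ Finset.univ, Integrable (fun x : ι → ℝ => ((∑ j, x j ^ 2 + ε)⁻¹) ^ (a + 1)
        - 2 * (a + 1) * (x i ^ 2 * ((∑ j, x j ^ 2 + ε)⁻¹) ^ (a + 2))) (piGaussian ι) :=
    fun i _ => (integrable_inv_sum_sq_add_pow hε (a + 1)).sub
        ((integrable_coord_pow_mul_inv_pow hε i 2 (a + 2)).const_mul _)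
  rw [← integral_finsetSum _ hint, ← integral_const_mul]
  refine integral_mono ((integrable_inv_sum_sq_add_pow hε (a + 1)).const_mul _)
    (integrable_finsetSum _ hint) fun x => ?_
  have h0 : 0 ≤ ∑ j, x j ^ 2 := Finset.sum_nonneg fun j _ => sq_nonneg _
  simp only [Finset.sum_sub_distrib, ← Finset.mul_sum, ← Finset.sum_mul, Finset.sum_const,
    Finset.card_univ, nsmul_eq_mul]
  have : (∑ j, x j ^ 2) * (∑ j, x j ^ 2 + ε)⁻¹ ≤ 1 := by
    rw [← div_eq_mul_inv, div_le_one (by positivity)]; linarith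
  have h3 : (∑ j, x j ^ 2) * ((∑ j, x j ^ 2 + ε)⁻¹) ^ (a + 2)
      ≤ ((∑ j, x j ^ 2 + ε)⁻¹) ^ (a + 1) := by
    calc _ = (∑ j, x j ^ 2) * (∑ j, x j ^ 2 + ε)⁻¹ * ((∑ j, x j ^ 2 + ε)⁻¹) ^ (a + 1) := by ring
      _ ≤ 1 * ((∑ j, x j ^ 2 + ε)⁻¹) ^ (a + 1) := by gcongr
      _ = _ := one_mul _
  nlinarith [mul_le_mul_of_nonneg_left h3 (by positivity : (0 : ℝ) ≤ 2 * (a + 1))]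

theorem integral_inv_sum_sq_add_pow_le {ε : ℝ} (hε : 0 < ε) (a : ℕ)
    (ha : 2 * a < Fintype.card ι) :
    ∫ x, ((∑ j, x j ^ 2 + ε)⁻¹) ^ a ∂(piGaussian ι)
      ≤ ∏ l ∈ Finset.range a, ((Fintype.card ι : ℝ) - 2 * (l + 1))⁻¹ := by
  induction a with
  | zero => simp
  | succ a ih =>
    have hpos : 0 < (Fintype.card ι : ℝ) - 2 * (a + 1) := by
      have : ((2 * (a + 1) : ℕ) : ℝ) < Fintype.card ι := by exact_mod_cast ha
      push_cast at this
      linarith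
    rw [Finset.prod_range_succ, ← div_eq_mul_inv, le_div_iff₀' hpos]
    exact (integral_inv_sum_sq_add_pow_succ_le hε a).trans (ih (by omega))

theorem lintegral_inv_sum_sq_pow_le (a : ℕ) (ha : 2 * a < Fintype.card ι) :
    ∫⁻ x, ((ENNReal.ofReal (∑ j, x j ^ 2))⁻¹) ^ a ∂(piGaussian ι)
      ≤ ENNReal.ofReal (∏ l ∈ Finset.range a, ((Fintype.card ι : ℝ) - 2 * (l + 1))⁻¹) := by
  have hε : ∀ n : ℕ, (0 : ℝ) < 1 / ((n : ℝ) + 1) := fun n => by positivity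
  have hlim : ∀ x : ι → ℝ, Filter.Tendsto
      (fun n : ℕ => ((ENNReal.ofReal (∑ j, x j ^ 2 + 1 / ((n : ℝ) + 1)))⁻¹) ^ a) Filter.atTop
      (nhds (((ENNReal.ofReal (∑ j, x j ^ 2))⁻¹) ^ a)) := by
    intro x
    have h1 : Filter.Tendsto (fun n : ℕ => ∑ j, x j ^ 2 + 1 / ((n : ℝ) + 1)) Filter.atTop
        (nhds (∑ j, x j ^ 2)) := by
      simpa using tendsto_one_div_add_atTop_nhds_zero_nat.const_add (∑ j, x j ^ 2)
    exact ((ENNReal.continuous_pow a).tendsto _).comp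
      ((continuous_inv.tendsto _).comp ((ENNReal.continuous_ofReal.tendsto _).comp h1))
  calc ∫⁻ x, ((ENNReal.ofReal (∑ j, x j ^ 2))⁻¹) ^ a ∂(piGaussian ι)
      = ∫⁻ x, Filter.liminf (fun n : ℕ =>
          ((ENNReal.ofReal (∑ j, x j ^ 2 + 1 / ((n : ℝ) + 1)))⁻¹) ^ a) Filter.atTop
            ∂(piGaussian ι) := lintegral_congr fun x => (hlim x).liminf_eq.symm
    _ ≤ Filter.liminf (fun n : ℕ => ∫⁻ x,
          ((ENNReal.ofReal (∑ j, x j ^ 2 + 1 / ((n : ℝ) + 1)))⁻¹) ^ a ∂(piGaussian ι))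
            Filter.atTop := lintegral_liminf_le fun n => by fun_prop
    _ ≤ _ := by
        refine Filter.liminf_le_of_frequently_le' (Filter.Frequently.of_forall fun n => ?_)
        have h0 : ∀ x : ι → ℝ, 0 < ∑ j, x j ^ 2 + 1 / ((n : ℝ) + 1) := fun x =>
          add_pos_of_nonneg_of_pos (Finset.sum_nonneg fun j _ => sq_nonneg _) (hε n)
        have hR : ∀ x : ι → ℝ, ((ENNReal.ofReal (∑ j, x j ^ 2 + 1 / ((n : ℝ) + 1)))⁻¹) ^ a
            = ENNReal.ofReal (((∑ j, x j ^ 2 + 1 / ((n : ℝ) + 1))⁻¹) ^ a) := fun x => by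
          rw [ENNReal.ofReal_pow (inv_nonneg.2 (h0 x).le), ENNReal.ofReal_inv_of_pos (h0 x)]
        rw [lintegral_congr hR,
          ← ofReal_integral_eq_lintegral_ofReal (integrable_inv_sum_sq_add_pow (hε n) a)
            (.of_forall fun x => pow_nonneg (inv_nonneg.2 (h0 x).le) a)]
        exact ENNReal.ofReal_le_ofReal (integral_inv_sum_sq_add_pow_le (hε n) a ha)

theorem integral_even_pow_gaussianReal (a : ℕ) :
    ∫ x, x ^ (2 * a) ∂(gaussianReal 0 1) = ∏ l ∈ Finset.range a, (2 * (l : ℝ) + 1) := by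
  have hint : ∀ n : ℕ, Integrable (fun x : ℝ => x ^ n) (gaussianReal 0 1) := by
    intro n
    have h1 : MemLp id (n : ENNReal) (gaussianReal 0 1) :=
      IsGaussian.memLp_id _ _ (ENNReal.natCast_ne_top n)
    rcases Nat.eq_zero_or_pos n with rfl | hn
    · simp
    · exact (h1.integrable_norm_pow hn.ne').mono' (by fun_prop) (.of_forall fun x => by simp)
  induction a with
  | zero => simp
  | succ a ih =>
    have h := integral_id_mul_gaussianReal (f := fun x => x ^ (2 * a + 1))
      (f' := fun x => (2 * (a : ℝ) + 1) * x ^ (2 * a))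
      (fun x => (hasDerivAt_pow (2 * a + 1) x).congr_deriv (by push_cast; rfl)) (hint _)
      (by simpa [← pow_succ'] using hint (2 * a + 2)) ((hint _).const_mul _)
    rw [integral_const_mul, ih] at h
    rw [Finset.prod_range_succ, mul_comm (∏ l ∈ _, _), ← h]
    refine integral_congr_ae (.of_forall fun x => ?_)
    simp only
    ring

theorem measurePreserving_comp_piGaussian {f : κ → ι} (hf : Function.Injective f) :
    MeasurePreserving (fun x : ι → ℝ => x ∘ f) (piGaussian ι) (piGaussian κ) := by
  classical
  have h := measurePreserving_mulVec_piGaussian ((1 : Matrix ι ι ℝ).submatrix f id) (by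
    rw [transpose_submatrix, transpose_one, ← submatrix_mul _ _ f id f Function.bijective_id,
      one_mul, submatrix_one f hf])
  convert h using 2 with x
  ext i
  simp [mulVec, dotProduct, one_apply]

theorem measurePreserving_sumElim_piGaussian :
    MeasurePreserving (fun q : (ι → ℝ) × (κ → ℝ) => Sum.elim q.1 q.2)
      ((piGaussian ι).prod (piGaussian κ)) (piGaussian (ι ⊕ κ)) := by
  have h := (measurePreserving_sumPiEquivProdPi (X := fun _ : ι ⊕ κ => ℝ)
    (fun _ => gaussianReal 0 1)).symm
  convert h using 1
  ext q i
  cases i <;> rfl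

theorem measurePreserving_sumElim_comp_piGaussian {α : Type*} [Fintype α] {f : α → ι ⊕ κ}
    (hf : Function.Injective f) :
    MeasurePreserving (fun q : (ι → ℝ) × (κ → ℝ) => Sum.elim q.1 q.2 ∘ f)
      ((piGaussian ι).prod (piGaussian κ)) (piGaussian α) :=
  (measurePreserving_comp_piGaussian hf).comp measurePreserving_sumElim_piGaussian

open scoped Kronecker in
theorem measurePreserving_mul_piGaussian {α : Type*} [Fintype α] [DecidableEq α]
    (U : Matrix α ι ℝ) (hU : U * Uᵀ = 1) :
    MeasurePreserving (fun (ω : ι × κ → ℝ) (q : α × κ) =>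
      (U * Matrix.of fun i j => ω (i, j)) q.1 q.2)
      (piGaussian (ι × κ)) (piGaussian (α × κ)) := by
  classical
  have h := measurePreserving_mulVec_piGaussian (U ⊗ₖ (1 : Matrix κ κ ℝ)) (by
    rw [← kroneckerMap_transpose, ← mul_kronecker_mul, hU]; simp)
  convert h using 2 with x
  ext ⟨i, j⟩
  simp [mulVec, dotProduct, mul_apply, one_apply, Fintype.sum_prod_type, kroneckerMap_apply]

theorem measurePreserving_mulVec_of_piGaussian {z : κ → ℝ} (hz : z ⬝ᵥ z = 1) :
    MeasurePreserving (fun (ω : ι × κ → ℝ) => (Matrix.of fun i j => ω (i, j)) *ᵥ z)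
      (piGaussian (ι × κ)) (piGaussian ι) := by
  classical
  have h := measurePreserving_mulVec_piGaussian
    (Matrix.of fun (i : ι) (q : ι × κ) => if q.1 = i then z q.2 else 0) (by
      ext i i'
      simp only [mul_apply, of_apply, transpose_apply, Fintype.sum_prod_type, one_apply]
      rw [Finset.sum_eq_single i (by intro b _ hb; simp [hb]) (by simp)]
      by_cases h : i = i'
      · simpa [h, dotProduct] using hz
      · simp [h])
  convert h using 2 with x
  ext i
  simp only [mulVec, dotProduct, of_apply, Fintype.sum_prod_type]
  rw [Finset.sum_eq_single i (by intro b _ hb; simp [hb]) (by simp)]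
  simp [mul_comm]

theorem lintegral_mulVec_le (c : ι → ℝ) (hc : ∀ i, 0 ≤ c i) (s : ℝ) (hs0 : 0 ≤ s)
    (hs : ∀ i, c i ≤ s) (a : ℕ) (z : κ → ℝ) :
    ∫⁻ ω : ι × κ → ℝ,
        ENNReal.ofReal (∑ i, c i * ((Matrix.of fun i j => ω (i, j)) *ᵥ z) i ^ 2) ^ a
        ∂(piGaussian (ι × κ))
      ≤ ENNReal.ofReal (z ⬝ᵥ z) ^ a *
        ENNReal.ofReal (∏ l ∈ Finset.range a, (∑ j, c j + 2 * l * s)) := by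
  have hz0 : 0 ≤ z ⬝ᵥ z := Finset.sum_nonneg fun i _ => mul_self_nonneg _
  rcases eq_or_ne (z ⬝ᵥ z) 0 with h0 | h0
  · have : z = 0 := dotProduct_self_eq_zero.mp h0
    subst this
    rcases Nat.eq_zero_or_pos a with rfl | ha
    · simp
    · simp [ha.ne']
  · set t := Real.sqrt (z ⬝ᵥ z)
    have ht2 : t * t = z ⬝ᵥ z := Real.mul_self_sqrt hz0
    have ht : t ≠ 0 := fun h => h0 (by rw [← ht2, h, zero_mul])
    have hu : (t⁻¹ • z) ⬝ᵥ (t⁻¹ • z) = 1 := by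
      rw [smul_dotProduct, dotProduct_smul, ← ht2, smul_eq_mul, smul_eq_mul]; field_simp
    have hmp := measurePreserving_mulVec_of_piGaussian (ι := ι) hu
    calc _ = ∫⁻ ω : ι × κ → ℝ, (fun h : ι → ℝ => ENNReal.ofReal (z ⬝ᵥ z) ^ a *
            ENNReal.ofReal (∑ i, c i * h i ^ 2) ^ a)
            ((Matrix.of fun i j => ω (i, j)) *ᵥ (t⁻¹ • z)) ∂(piGaussian (ι × κ)) := by
          refine lintegral_congr fun ω => ?_
          simp only []
          rw [← mul_pow, ← ENNReal.ofReal_mul hz0, Finset.mul_sum]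
          refine congrArg (fun x => ENNReal.ofReal x ^ a) (Finset.sum_congr rfl fun i _ => ?_)
          rw [mulVec_smul, Pi.smul_apply, smul_eq_mul, ← ht2]
          field_simp
      _ = ∫⁻ h, ENNReal.ofReal (z ⬝ᵥ z) ^ a *
            ENNReal.ofReal (∑ i, c i * h i ^ 2) ^ a ∂(piGaussian ι) := by
          have hf : Measurable fun h : ι → ℝ => ENNReal.ofReal (z ⬝ᵥ z) ^ a *
            ENNReal.ofReal (∑ i, c i * h i ^ 2) ^ a := by fun_prop
          exact hmp.lintegral_comp hf
      _ ≤ _ := by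
          rw [lintegral_const_mul _ (by fun_prop)]
          gcongr
          exact lintegral_sum_mul_sq_pow_le c hc s hs0 hs a

theorem lintegral_dotProduct_pow (w : ι → ℝ) (a : ℕ) :
    ∫⁻ g, ENNReal.ofReal ((w ⬝ᵥ g) ^ 2) ^ a ∂(piGaussian ι)
      = ENNReal.ofReal ((w ⬝ᵥ w) ^ a * ∏ l ∈ Finset.range a, (2 * (l : ℝ) + 1)) := by
  have hz0 : 0 ≤ w ⬝ᵥ w := Finset.sum_nonneg fun i _ => mul_self_nonneg _
  rcases eq_or_ne (w ⬝ᵥ w) 0 with h0 | h0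
  · have : w = 0 := dotProduct_self_eq_zero.mp h0
    subst this
    rcases Nat.eq_zero_or_pos a with rfl | ha
    · simp
    · simp [ha.ne']
  · set t := Real.sqrt (w ⬝ᵥ w)
    have ht2 : t * t = w ⬝ᵥ w := Real.mul_self_sqrt hz0
    have ht : t ≠ 0 := fun h => h0 (by rw [← ht2, h, zero_mul])
    have hmp := measurePreserving_mulVec_piGaussian (Matrix.of fun (_ : Unit) => t⁻¹ • w) (by
      ext
      simp only [mul_apply, of_apply, transpose_apply, one_apply, if_true]
      change (t⁻¹ • w) ⬝ᵥ (t⁻¹ • w) = 1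
      rw [smul_dotProduct, dotProduct_smul, ← ht2, smul_eq_mul, smul_eq_mul]; field_simp)
    have hev : MeasurePreserving (fun x : Unit → ℝ => x ()) (piGaussian Unit) (gaussianReal 0 1) :=
      measurePreserving_eval (μ := fun _ : Unit => gaussianReal 0 1) ()
    calc _ = ∫⁻ g, (fun x : ℝ => ENNReal.ofReal ((w ⬝ᵥ w) ^ a) * ENNReal.ofReal (x ^ (2 * a)))
              ((fun x : Unit → ℝ => x ()) ((Matrix.of fun (_ : Unit) => t⁻¹ • w) *ᵥ g))
              ∂(piGaussian ι) := by
          refine lintegral_congr fun g => ?_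
          simp only []
          rw [← ENNReal.ofReal_pow (sq_nonneg _), ← ENNReal.ofReal_mul (by positivity)]
          congr 1
          simp only [mulVec, of_apply, smul_dotProduct, smul_eq_mul]
          rw [← ht2, pow_mul, ← mul_pow]
          congr 1
          field_simp
      _ = ∫⁻ x, ENNReal.ofReal ((w ⬝ᵥ w) ^ a) * ENNReal.ofReal (x ^ (2 * a))
          ∂(gaussianReal 0 1) := by
          have hf : Measurable fun x : ℝ => ENNReal.ofReal ((w ⬝ᵥ w) ^ a) *
            ENNReal.ofReal (x ^ (2 * a)) := by fun_prop
          exact (hev.comp hmp).lintegral_comp hf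
      _ = _ := by
          rw [lintegral_const_mul _ (by fun_prop), ENNReal.ofReal_mul (by positivity),
            ← integral_even_pow_gaussianReal, ofReal_integral_eq_lintegral_ofReal]
          · have := (memLp_id_gaussianReal (μ := 0) (v := 1) ((2 * a : ℕ) : NNReal)).integrable_norm_pow'
            simpa [pow_mul] using this
          · exact .of_forall fun x => (even_two_mul a).pow_nonneg x

theorem exists_coisometry_mulVec_eq_zero (G : Matrix ι κ ℝ) (i : ι) {d : ℕ}
    (hd : d + Fintype.card ι ≤ Fintype.card κ + 1) :
    ∃ B : Matrix (Fin d) κ ℝ, B * Bᵀ = 1 ∧ ∀ j ≠ i, B *ᵥ G j = 0 := by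
  classical
  let S : Submodule ℝ (EuclideanSpace ℝ κ) :=
    Submodule.span ℝ (Set.range fun j : {j // j ≠ i} => WithLp.toLp 2 (G j))
  have hS : Module.finrank ℝ S ≤ Fintype.card ι - 1 := by
    refine (finrank_range_le_card _).trans ?_
    simp [Fintype.card_subtype_compl]
  have hS' : d ≤ Module.finrank ℝ Sᗮ := by
    have h := S.finrank_add_finrank_orthogonal
    rw [finrank_euclideanSpace] at h
    have : 0 < Fintype.card ι := Fintype.card_pos_iff.mpr ⟨i⟩
    omega
  let b := stdOrthonormalBasis ℝ Sᗮ
  refine ⟨Matrix.of fun l => (b (Fin.castLE hS' l) : EuclideanSpace ℝ κ).ofLp, ?_, fun j hj => ?_⟩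
  · ext l l'
    have h := orthonormal_iff_ite.mp b.orthonormal (Fin.castLE hS' l') (Fin.castLE hS' l)
    rw [Submodule.coe_inner, EuclideanSpace.inner_eq_star_dotProduct, star_trivial] at h
    simp only [Fin.castLE_inj] at h
    simpa [mul_apply, dotProduct, one_apply, eq_comm] using h
  · ext l
    have h := Submodule.mem_orthogonal _ _ |>.mp (b (Fin.castLE hS' l)).2 (WithLp.toLp 2 (G j))
      (Submodule.subset_span ⟨⟨j, hj⟩, rfl⟩)
    rw [EuclideanSpace.inner_eq_star_dotProduct, star_trivial] at h
    simpa [mulVec] using h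

theorem dotProduct_mulVec_self_le {B : Matrix ι κ ℝ} [DecidableEq ι] (hB : B * Bᵀ = 1)
    (v : κ → ℝ) : (B *ᵥ v) ⬝ᵥ (B *ᵥ v) ≤ v ⬝ᵥ v := by
  have h : 0 ≤ (v - Bᵀ *ᵥ (B *ᵥ v)) ⬝ᵥ (v - Bᵀ *ᵥ (B *ᵥ v)) :=
    Finset.sum_nonneg fun i _ => mul_self_nonneg _
  have h1 : v ⬝ᵥ (Bᵀ *ᵥ (B *ᵥ v)) = (B *ᵥ v) ⬝ᵥ (B *ᵥ v) := by
    rw [dotProduct_mulVec, vecMul_transpose]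
  have h2 : (Bᵀ *ᵥ (B *ᵥ v)) ⬝ᵥ (Bᵀ *ᵥ (B *ᵥ v)) = (B *ᵥ v) ⬝ᵥ (B *ᵥ v) := by
    rw [dotProduct_mulVec, vecMul_transpose, mulVec_mulVec, hB, one_mulVec]
  rw [sub_dotProduct, dotProduct_sub, dotProduct_sub, h2,
    dotProduct_comm (Bᵀ *ᵥ (B *ᵥ v)) v, h1] at h
  linarith

theorem dotProduct_gram_add_smul_one_mulVec [DecidableEq ι] (G : Matrix ι κ ℝ) (ε : ℝ)
    (y : ι → ℝ) :
    y ⬝ᵥ ((G * Gᵀ + ε • 1) *ᵥ y) = (Gᵀ *ᵥ y) ⬝ᵥ (Gᵀ *ᵥ y) + ε * (y ⬝ᵥ y) := by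
  rw [add_mulVec, dotProduct_add, smul_mulVec, one_mulVec, dotProduct_smul, smul_eq_mul,
    ← mulVec_mulVec, dotProduct_mulVec, ← mulVec_transpose]

theorem ofReal_inv_apply_self_le [DecidableEq ι] (G : Matrix ι κ ℝ) {ε : ℝ} (hε : 0 ≤ ε) (i : ι)
    {α : Type*} [Fintype α] [DecidableEq α] {B : Matrix α κ ℝ} (hB : B * Bᵀ = 1)
    (hBG : ∀ j ≠ i, B *ᵥ G j = 0) :
    ENNReal.ofReal ((G * Gᵀ + ε • (1 : Matrix ι ι ℝ))⁻¹ i i) ≤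
      (ENNReal.ofReal (∑ l, (B *ᵥ G i) l ^ 2))⁻¹ := by
  by_cases hu : IsUnit (G * Gᵀ + ε • (1 : Matrix ι ι ℝ)).det
  · set M := G * Gᵀ + ε • (1 : Matrix ι ι ℝ) with hM
    set y := M⁻¹ *ᵥ Pi.single i 1
    have hy : y i = M⁻¹ i i := by simp [y]
    have hMy : M *ᵥ y = Pi.single i 1 := by
      simp only [y, mulVec_mulVec, mul_nonsing_inv _ hu, one_mulVec]
    have h1 := dotProduct_gram_add_smul_one_mulVec G ε y
    rw [← hM, hMy, dotProduct_single_one] at h1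
    have h2 : B *ᵥ (Gᵀ *ᵥ y) = y i • (B *ᵥ G i) := by
      have : Gᵀ *ᵥ y = ∑ j, y j • G j := by
        ext l; simp [mulVec, dotProduct, mul_comm, Finset.sum_apply]
      rw [this, mulVec_sum, Finset.sum_eq_single i (fun j _ hj => by
        rw [mulVec_smul, hBG j hj, smul_zero]) (by simp), mulVec_smul]
    have h3 := dotProduct_mulVec_self_le hB (Gᵀ *ᵥ y)
    rw [h2, smul_dotProduct, dotProduct_smul, smul_eq_mul, smul_eq_mul] at h3
    have h4 : (B *ᵥ G i) ⬝ᵥ (B *ᵥ G i) = ∑ l, (B *ᵥ G i) l ^ 2 := by simp [dotProduct, sq]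
    rw [h4] at h3
    have h5 : 0 ≤ y ⬝ᵥ y := Finset.sum_nonneg fun i _ => mul_self_nonneg _
    have h6 := mul_nonneg hε h5
    rw [← hy, ENNReal.le_inv_iff_mul_le]
    rcases le_or_gt (y i) 0 with h0 | h0
    · simp [ENNReal.ofReal_of_nonpos h0]
    · rw [← ENNReal.ofReal_mul h0.le, ENNReal.ofReal_le_one]
      have : y i * (y i * ∑ l, (B *ᵥ G i) l ^ 2) ≤ y i * 1 := by linarith
      exact le_of_mul_le_mul_left this h0
  · simp [nonsing_inv_apply_not_isUnit _ hu]

theorem measurable_det_matrix {α : Type*} [MeasurableSpace α] [DecidableEq ι]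
    {M : α → Matrix ι ι ℝ} (hM : ∀ i j, Measurable fun x => M x i j) :
    Measurable fun x => (M x).det := by
  simp only [det_apply]
  fun_prop

theorem measurable_matrix_inv_apply {α : Type*} [MeasurableSpace α] [DecidableEq ι]
    {M : α → Matrix ι ι ℝ} (hM : ∀ i j, Measurable fun x => M x i j) (i j : ι) :
    Measurable fun x => (M x)⁻¹ i j := by
  simp only [inv_def, Ring.inverse_eq_inv', Matrix.smul_apply, smul_eq_mul, adjugate_apply]
  refine (measurable_det_matrix hM).inv.mul (measurable_det_matrix fun i' j' => ?_)
  simp only [updateRow_apply]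
  split_ifs
  · fun_prop
  · exact hM i' j'

theorem measurable_inv_gram_apply [DecidableEq ι] (ε : ℝ) (i j : ι) :
    Measurable fun ω : ι × κ → ℝ => ((Matrix.of fun i j => ω (i, j)) *
        (Matrix.of fun i j => ω (i, j))ᵀ + ε • (1 : Matrix ι ι ℝ))⁻¹ i j := by
  refine measurable_matrix_inv_apply (fun i j => ?_) i j
  simp only [Matrix.add_apply, mul_apply, of_apply, transpose_apply]
  fun_prop

theorem lintegral_inv_apply_self_pow_le [DecidableEq ι] {d a : ℕ} (ha : 2 * a < d)
    (hd : d + Fintype.card ι ≤ Fintype.card κ + 1) {ε : ℝ} (hε : 0 ≤ ε) (i : ι) :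
    ∫⁻ ω : ι × κ → ℝ, ENNReal.ofReal (((Matrix.of fun i j => ω (i, j)) *
        (Matrix.of fun i j => ω (i, j))ᵀ + ε • (1 : Matrix ι ι ℝ))⁻¹ i i) ^ a ∂(piGaussian (ι × κ))
      ≤ ENNReal.ofReal (∏ l ∈ Finset.range a, ((d : ℝ) - 2 * (l + 1))⁻¹) := by
  let f : ι × κ → (ι × κ) ⊕ κ := fun q => if q.1 = i then Sum.inr q.2 else Sum.inl q
  have hf : Function.Injective f := by
    rintro ⟨x, y⟩ ⟨x', y'⟩ h
    by_cases h1 : x = i <;> by_cases h2 : x' = i <;> simp_all [f]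
  have hmp := measurePreserving_sumElim_comp_piGaussian hf
  have hmeas : Measurable fun ω : ι × κ → ℝ => ENNReal.ofReal (((Matrix.of fun i j => ω (i, j)) *
        (Matrix.of fun i j => ω (i, j))ᵀ + ε • (1 : Matrix ι ι ℝ))⁻¹ i i) ^ a := by
    exact (ENNReal.measurable_ofReal.comp (measurable_inv_gram_apply ε i i)).pow_const a
  rw [← hmp.lintegral_comp hmeas]
  refine (lintegral_prod_le _).trans ?_
  calc _ ≤ ∫⁻ _ : ι × κ → ℝ, ENNReal.ofReal (∏ l ∈ Finset.range a, ((d : ℝ) - 2 * (l + 1))⁻¹)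
          ∂(piGaussian (ι × κ)) := by
        refine lintegral_mono fun ω => ?_
        obtain ⟨B, hB, hBG⟩ := exists_coisometry_mulVec_eq_zero (Matrix.of fun i j => ω (i, j)) i hd
        have hmp' := measurePreserving_mulVec_piGaussian B hB
        have hm' : Measurable fun x : Fin d → ℝ => ((ENNReal.ofReal (∑ j, x j ^ 2))⁻¹) ^ a := by
          fun_prop
        calc _ ≤ ∫⁻ z : κ → ℝ, ((ENNReal.ofReal (∑ l, (B *ᵥ z) l ^ 2))⁻¹) ^ a ∂(piGaussian κ) := by
              refine lintegral_mono fun z => ?_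
              simp only []
              gcongr
              set G : Matrix ι κ ℝ := Matrix.of fun i j => (Sum.elim ω z ∘ f) (i, j)
              have h1 : G i = z := by ext; simp [G, f]
              have h2 : ∀ j ≠ i, G j = fun l => ω (j, l) := by
                intro j hj; ext; simp [G, f, hj]
              have := ofReal_inv_apply_self_le G hε i hB
                (fun j hj => by rw [h2 j hj]; exact hBG j hj)
              rwa [h1] at this
          _ ≤ _ := by
              rw [hmp'.lintegral_comp hm']
              refine (lintegral_inv_sum_sq_pow_le a (by simpa using ha)).trans_eq ?_
              simp
    _ = _ := by simp

theorem isUnit_det_gram_add_smul_one [DecidableEq ι] (G : Matrix ι κ ℝ) {ε : ℝ} (hε : 0 < ε) :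
    IsUnit (G * Gᵀ + ε • (1 : Matrix ι ι ℝ)).det := by
  rw [isUnit_iff_ne_zero]
  intro h
  obtain ⟨v, hv0, hv⟩ := exists_mulVec_eq_zero_iff.mpr h
  have h1 := dotProduct_gram_add_smul_one_mulVec G ε v
  rw [hv, dotProduct_zero] at h1
  have h2 : 0 ≤ (Gᵀ *ᵥ v) ⬝ᵥ (Gᵀ *ᵥ v) := Finset.sum_nonneg fun i _ => mul_self_nonneg _
  have h3 : 0 ≤ v ⬝ᵥ v := Finset.sum_nonneg fun i _ => mul_self_nonneg _
  have h4 : v ⬝ᵥ v = 0 := by nlinarith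
  exact hv0 (dotProduct_self_eq_zero.mp h4)

theorem one_le_mul_trace_inv_of_det_eq_zero [DecidableEq ι] (G : Matrix ι κ ℝ) {ε : ℝ} (hε : 0 < ε)
    (hG : (G * Gᵀ).det = 0) : 1 ≤ ε * ∑ i, (G * Gᵀ + ε • (1 : Matrix ι ι ℝ))⁻¹ i i := by
  obtain ⟨y, hy0, hy⟩ := exists_mulVec_eq_zero_iff.mpr hG
  have hu := isUnit_det_gram_add_smul_one G hε
  set M := G * Gᵀ + ε • (1 : Matrix ι ι ℝ) with hM
  have hMT : M⁻¹ᵀ = M⁻¹ := by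
    rw [transpose_nonsing_inv, hM]
    simp
  have hMy : M *ᵥ y = ε • y := by rw [hM, add_mulVec, hy, zero_add, smul_mulVec, one_mulVec]
  have hRy : ε • (M⁻¹ *ᵥ y) = y := by
    rw [← mulVec_smul, ← hMy, mulVec_mulVec, nonsing_inv_mul _ hu, one_mulVec]
  have hyy : 0 < y ⬝ᵥ y :=
    lt_of_le_of_ne (Finset.sum_nonneg fun i _ => mul_self_nonneg _)
      (fun h => hy0 (dotProduct_self_eq_zero.mp h.symm))
  have key : ∀ i, y i ^ 2 ≤ ε * M⁻¹ i i * (y ⬝ᵥ y) := by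
    intro i
    set z := M⁻¹ *ᵥ Pi.single i 1
    have hMz : M *ᵥ z = Pi.single i 1 := by
      simp only [z, mulVec_mulVec, mul_nonsing_inv _ hu, one_mulVec]
    have h1 := dotProduct_gram_add_smul_one_mulVec G ε z
    rw [← hM, hMz, dotProduct_single_one] at h1
    have h2 : 0 ≤ (Gᵀ *ᵥ z) ⬝ᵥ (Gᵀ *ᵥ z) := Finset.sum_nonneg fun i _ => mul_self_nonneg _
    have h3 : z i = M⁻¹ i i := by simp [z]
    have h4 : ε * (z ⬝ᵥ y) = y i := by
      have : z ⬝ᵥ y = (M⁻¹ *ᵥ y) i := by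
        rw [← single_one_dotProduct i (M⁻¹ *ᵥ y), dotProduct_mulVec, ← mulVec_transpose, hMT]
      rw [this, ← smul_eq_mul, ← Pi.smul_apply, hRy]
    have h5 : (z ⬝ᵥ y) ^ 2 ≤ (z ⬝ᵥ z) * (y ⬝ᵥ y) := by
      simpa [dotProduct, sq] using Finset.sum_mul_sq_le_sq_mul_sq Finset.univ z y
    rw [← h4, ← h3, mul_pow]
    calc ε ^ 2 * (z ⬝ᵥ y) ^ 2 ≤ ε ^ 2 * ((z ⬝ᵥ z) * (y ⬝ᵥ y)) := by gcongr
      _ = ε * (ε * (z ⬝ᵥ z)) * (y ⬝ᵥ y) := by ring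
      _ ≤ ε * z i * (y ⬝ᵥ y) := by gcongr; linarith
  have hsum : y ⬝ᵥ y ≤ ε * (∑ i, M⁻¹ i i) * (y ⬝ᵥ y) := by
    calc y ⬝ᵥ y = ∑ i, y i ^ 2 := by simp [dotProduct, sq]
      _ ≤ ∑ i, ε * M⁻¹ i i * (y ⬝ᵥ y) := Finset.sum_le_sum fun i _ => key i
      _ = _ := by rw [Finset.mul_sum, Finset.sum_mul]
  exact le_of_mul_le_mul_right (by rwa [one_mul]) hyy

theorem ae_isUnit_det_gram [DecidableEq ι] (h : Fintype.card ι + 2 ≤ Fintype.card κ) :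
    ∀ᵐ ω ∂(piGaussian (ι × κ)), IsUnit ((Matrix.of fun i j => ω (i, j)) *
        (Matrix.of fun i j => ω (i, j))ᵀ : Matrix ι ι ℝ).det := by
  rw [ae_iff]
  set D := {ω : ι × κ → ℝ | ¬ IsUnit ((Matrix.of fun i j => ω (i, j)) *
        (Matrix.of fun i j => ω (i, j))ᵀ : Matrix ι ι ℝ).det} with hD
  by_contra hne
  obtain ⟨n, hn⟩ := ENNReal.exists_nat_mul_gt hne (ENNReal.natCast_ne_top (Fintype.card ι))
  have hn0 : 0 < n := Nat.pos_of_ne_zero (by rintro rfl; simp at hn)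
  set ε : ℝ := (n : ℝ)⁻¹
  have hε : 0 < ε := by positivity
  let R : ι → (ι × κ → ℝ) → ENNReal := fun i ω =>
    ENNReal.ofReal (((Matrix.of fun i j => ω (i, j)) *
        (Matrix.of fun i j => ω (i, j))ᵀ + ε • (1 : Matrix ι ι ℝ))⁻¹ i i)
  have hmeas : ∀ i, Measurable (R i) := fun i =>
    ENNReal.measurable_ofReal.comp (measurable_inv_gram_apply ε i i)
  have h1 : ∀ i, ∫⁻ ω, R i ω ∂(piGaussian (ι × κ)) ≤ 1 := by
    intro i
    have := lintegral_inv_apply_self_pow_le (ι := ι) (κ := κ) (d := 3) (a := 1) (by norm_num)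
      (by omega) hε.le i
    simp only [pow_one, Finset.prod_range_one] at this
    refine this.trans_eq ?_
    norm_num
  have h2 : (n : ENNReal) * piGaussian (ι × κ) D ≤ ∫⁻ ω, ∑ i, R i ω ∂(piGaussian (ι × κ)) := by
    refine le_trans ?_ (mul_meas_ge_le_lintegral (Finset.measurable_sum _ fun i _ => hmeas i) n)
    gcongr
    intro ω hω
    have hdet := not_not.mp (mt isUnit_iff_ne_zero.mpr hω)
    have h3 := one_le_mul_trace_inv_of_det_eq_zero _ hε hdet
    rw [inv_mul_eq_div, one_le_div (by positivity)] at h3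
    change (n : ENNReal) ≤ ∑ i, R i ω
    calc (n : ENNReal) = ENNReal.ofReal n := by simp
      _ ≤ _ := ENNReal.ofReal_le_ofReal h3
      _ ≤ ∑ i, R i ω := Finset.le_sum_of_subadditive _ ENNReal.ofReal_zero.le
        (fun _ _ => ENNReal.ofReal_add_le) _ _
  refine absurd hn (not_lt.mpr (h2.trans ?_))
  rw [lintegral_finsetSum _ fun i _ => hmeas i]
  exact (Finset.sum_le_sum fun i _ => h1 i).trans (by simp)

theorem measurable_inv_gram [DecidableEq ι] (i j : ι) :
    Measurable fun ω : ι × κ → ℝ => ((Matrix.of fun i j => ω (i, j)) *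
        (Matrix.of fun i j => ω (i, j))ᵀ : Matrix ι ι ℝ)⁻¹ i j := by
  have := measurable_inv_gram_apply (ι := ι) (κ := κ) 0 i j
  simpa only [zero_smul, add_zero] using this

theorem measurable_mulVec_apply {ι α : Type*} [MeasurableSpace α] {M : α → Matrix ι κ ℝ}
    {v : α → κ → ℝ} (hM : ∀ i j, Measurable fun x => M x i j) (hv : ∀ j, Measurable fun x => v x j)
    (i : ι) : Measurable fun x => (M x *ᵥ v x) i := by
  simp only [mulVec, dotProduct]
  fun_prop

theorem exists_orthogonal_row_eq [DecidableEq ι] (i : ι) {v : ι → ℝ} (hv : v ⬝ᵥ v = 1) :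
    ∃ U : Matrix ι ι ℝ, U * Uᵀ = 1 ∧ U i = v := by
  have hon : Orthonormal ℝ (({i} : Set ι).domRestrict fun _ => WithLp.toLp 2 v) := by
    rw [orthonormal_iff_ite]
    rintro ⟨a, rfl⟩ ⟨b, rfl⟩
    rw [if_pos rfl, Set.domRestrict_apply, EuclideanSpace.inner_eq_star_dotProduct, star_trivial]
    exact hv
  obtain ⟨b, hb⟩ := hon.exists_orthonormalBasis_extension_of_card_eq (by simp)
  refine ⟨Matrix.of fun l => (b l).ofLp, ?_, ?_⟩
  · ext l l'
    have h := orthonormal_iff_ite.mp b.orthonormal l' l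
    rw [EuclideanSpace.inner_eq_star_dotProduct, star_trivial] at h
    simpa [mul_apply, dotProduct, one_apply, eq_comm] using h
  · have := hb i rfl
    change (b i).ofLp = v
    rw [this]

theorem lintegral_dotProduct_inv_gram_pow_le [DecidableEq ι] {d a : ℕ} (ha : 2 * a < d)
    (hd : d + Fintype.card ι ≤ Fintype.card κ + 1) (g : ι → ℝ) :
    ∫⁻ ω : ι × κ → ℝ, ENNReal.ofReal (g ⬝ᵥ (((Matrix.of fun i j => ω (i, j)) *
        (Matrix.of fun i j => ω (i, j))ᵀ : Matrix ι ι ℝ)⁻¹ *ᵥ g)) ^ a ∂(piGaussian (ι × κ))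
      ≤ ENNReal.ofReal (g ⬝ᵥ g) ^ a *
        ENNReal.ofReal (∏ l ∈ Finset.range a, ((d : ℝ) - 2 * (l + 1))⁻¹) := by
  have hz0 : 0 ≤ g ⬝ᵥ g := Finset.sum_nonneg fun i _ => mul_self_nonneg _
  rcases eq_or_ne (g ⬝ᵥ g) 0 with h0 | h0
  · have : g = 0 := dotProduct_self_eq_zero.mp h0
    subst this
    rcases Nat.eq_zero_or_pos a with rfl | ha
    · simp
    · simp [ha.ne']
  · obtain ⟨i, hi⟩ : ∃ i, g i ≠ 0 := by
      by_contra! h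
      exact h0 (by simp [dotProduct, h])
    set t := Real.sqrt (g ⬝ᵥ g)
    have ht2 : t * t = g ⬝ᵥ g := Real.mul_self_sqrt hz0
    have ht : t ≠ 0 := fun h => h0 (by rw [← ht2, h, zero_mul])
    have hu : (t⁻¹ • g) ⬝ᵥ (t⁻¹ • g) = 1 := by
      rw [smul_dotProduct, dotProduct_smul, ← ht2, smul_eq_mul, smul_eq_mul]; field_simp
    obtain ⟨U, hU, hUi⟩ := exists_orthogonal_row_eq i hu
    have hU' : Uᵀ * U = 1 := mul_eq_one_comm.mp hU
    have hmp := measurePreserving_mul_piGaussian (κ := κ) U hU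
    have hm : Measurable fun ω : ι × κ → ℝ => ENNReal.ofReal (((Matrix.of fun i j => ω (i, j)) *
        (Matrix.of fun i j => ω (i, j))ᵀ : Matrix ι ι ℝ)⁻¹ i i) ^ a := by
      exact (ENNReal.measurable_ofReal.comp (measurable_inv_gram i i)).pow_const a
    have h1 := lintegral_inv_apply_self_pow_le (ι := ι) (κ := κ) ha hd le_rfl i
    simp only [zero_smul, add_zero] at h1
    rw [← hmp.lintegral_comp hm] at h1
    calc _ = ∫⁻ ω : ι × κ → ℝ, ENNReal.ofReal (g ⬝ᵥ g) ^ a *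
            ENNReal.ofReal (((U * Matrix.of fun i j => ω (i, j)) *
              (U * Matrix.of fun i j => ω (i, j))ᵀ : Matrix ι ι ℝ)⁻¹ i i) ^ a
            ∂(piGaussian (ι × κ)) := by
          refine lintegral_congr fun ω => ?_
          set G : Matrix ι κ ℝ := Matrix.of fun i j => ω (i, j)
          have h2 : ((U * G) * (U * G)ᵀ)⁻¹ = U * (G * Gᵀ)⁻¹ * Uᵀ := by
            have : (U * G) * (U * G)ᵀ = U * (G * Gᵀ) * Uᵀ := by
              rw [transpose_mul]; simp only [Matrix.mul_assoc]
            rw [this, Matrix.mul_inv_rev, Matrix.mul_inv_rev, inv_eq_right_inv hU, inv_eq_right_inv hU',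
              Matrix.mul_assoc]
          have h3 : (U * (G * Gᵀ)⁻¹ * Uᵀ) i i = (t⁻¹ • g) ⬝ᵥ ((G * Gᵀ)⁻¹ *ᵥ (t⁻¹ • g)) := by
            rw [← hUi, dotProduct_mulVec]
            rfl
          rw [h2, h3, ← mul_pow, ← ENNReal.ofReal_mul hz0, mulVec_smul, smul_dotProduct,
            dotProduct_smul, smul_eq_mul, smul_eq_mul, ← ht2]
          congr 2
          field_simp
      _ ≤ _ := by
          rw [lintegral_const_mul']
          · gcongr
            exact h1
          · exact ENNReal.pow_ne_top ENNReal.ofReal_ne_top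

theorem lintegral_lintegral_sketch_le {ρ : Type*} [Fintype ρ] [DecidableEq ρ] {f : ρ → ι}
    (hf : Function.Injective f) {c : ι → ℝ} (hc : ∀ i, 0 ≤ c i) (hcf : ∀ i, c (f i) = 0) {s : ℝ}
    (hs0 : 0 ≤ s) (hs : ∀ i, c i ≤ s) {d a : ℕ} (ha : 2 * a < d)
    (hd : d + Fintype.card ρ ≤ Fintype.card κ + 1)
    {Φ : (ι × κ → ℝ) → (ι × κ → ℝ) → (ρ → ℝ) → ENNReal}
    (hΦ : ∀ ω' ω g, Φ ω' ω g = ENNReal.ofReal (∑ j, c j * ((Matrix.of fun i j => ω' (i, j)) *ᵥ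
      ((Matrix.of fun i j => ω (f i, j))ᵀ *ᵥ (((Matrix.of fun i j => ω (f i, j)) *
        (Matrix.of fun i j => ω (f i, j))ᵀ : Matrix ρ ρ ℝ)⁻¹ *ᵥ g))) j ^ 2) ^ a) :
    Measurable (fun ω => ∫⁻ g, Φ ω ω g ∂(piGaussian ρ)) ∧
    ∫⁻ ω, ∫⁻ g, Φ ω ω g ∂(piGaussian ρ) ∂(piGaussian (ι × κ)) ≤
      ENNReal.ofReal ((∏ l ∈ Finset.range a, ((Fintype.card ρ : ℝ) + 2 * l)) *
        (∏ l ∈ Finset.range a, ((d : ℝ) - 2 * (l + 1))⁻¹) *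
        ∏ l ∈ Finset.range a, (∑ j, c j + 2 * l * s)) := by
  classical
  have hfi : Function.Injective (Prod.map f (id : κ → κ)) := hf.prodMap Function.injective_id
  have hG := measurePreserving_comp_piGaussian hfi
  have hinv : ∀ i j, Measurable fun ω : ι × κ → ℝ => ((Matrix.of fun i j => ω (f i, j)) *
        (Matrix.of fun i j => ω (f i, j))ᵀ : Matrix ρ ρ ℝ)⁻¹ i j := by
    intro i j
    refine measurable_matrix_inv_apply (fun i j => ?_) i j
    simp only [mul_apply, of_apply, transpose_apply]
    fun_prop
  have hmeas : Measurable fun q : (ι × κ → ℝ) × (ι × κ → ℝ) × (ρ → ℝ) => Φ q.1 q.2.1 q.2.2 := by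
    simp only [hΦ]
    let G : (ι × κ → ℝ) × (ι × κ → ℝ) × (ρ → ℝ) → Matrix ρ κ ℝ := fun q =>
      Matrix.of fun i j => q.2.1 (f i, j)
    have mG : ∀ i j, Measurable fun q => G q i j := fun i j => by
      simp only [G, of_apply]; fun_prop
    have mR : ∀ i j, Measurable fun q => (G q * (G q)ᵀ)⁻¹ i j := fun i j =>
      (hinv i j).comp (measurable_fst.comp measurable_snd)
    have m1 := measurable_mulVec_apply (v := fun q => q.2.2) mR fun l => by fun_prop
    have m2 := measurable_mulVec_apply (M := fun q => (G q)ᵀ) (fun i j => mG j i) m1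
    have m3 := measurable_mulVec_apply (M := fun q : (ι × κ → ℝ) × (ι × κ → ℝ) × (ρ → ℝ) =>
      Matrix.of fun i j => q.1 (i, j)) (fun i j => by simp only [of_apply]; fun_prop) m2
    exact (ENNReal.measurable_ofReal.comp (Finset.measurable_sum _ fun j _ =>
      ((m3 j).pow_const 2).const_mul (c j))).pow_const a
  have hdiag : Measurable (fun ω => ∫⁻ g, Φ ω ω g ∂(piGaussian ρ)) := by
    refine Measurable.lintegral_prod_right' (f := fun q : (ι × κ → ℝ) × (ρ → ℝ) => Φ q.1 q.1 q.2) ?_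
    exact hmeas.comp (measurable_fst.prodMk (measurable_fst.prodMk measurable_snd))
  refine ⟨hdiag, ?_⟩
  let sel : ι × κ → (ι × κ) ⊕ (ι × κ) := fun q =>
    if q.1 ∈ Set.range f then Sum.inl q else Sum.inr q
  have hsel : Function.Injective sel := by
    intro q q' h
    by_cases h1 : q.1 ∈ Set.range f <;> by_cases h2 : q'.1 ∈ Set.range f <;>
      simp only [sel, h1, h2, if_true, if_false, Sum.inl.injEq, Sum.inr.injEq, reduceCtorEq] at h <;>
      exact h
  have hmp := measurePreserving_sumElim_comp_piGaussian hsel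
  set C1 := ∏ l ∈ Finset.range a, (∑ j, c j + 2 * l * s)
  set C2 := ∏ l ∈ Finset.range a, ((d : ℝ) - 2 * (l + 1))⁻¹
  set C3 := ∏ l ∈ Finset.range a, ((Fintype.card ρ : ℝ) + 2 * l)
  have hmerge : ∀ ω ω' g, Φ (Sum.elim ω ω' ∘ sel) (Sum.elim ω ω' ∘ sel) g = Φ ω' ω g := by
    intro ω ω' g
    have h1 : ∀ i j, (Sum.elim ω ω' ∘ sel) (f i, j) = ω (f i, j) := by
      intro i j; simp [sel]
    rw [hΦ, hΦ]
    simp only [h1]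
    refine congrArg (fun x => ENNReal.ofReal x ^ a) (Finset.sum_congr rfl fun j _ => ?_)
    by_cases hj : j ∈ Set.range f
    · obtain ⟨i, rfl⟩ := hj
      simp [hcf]
    · have : ∀ l, (Sum.elim ω ω' ∘ sel) (j, l) = ω' (j, l) := by
        intro l; simp only [Function.comp, sel, hj, if_false, Sum.elim_inr]
      simp only [mulVec, of_apply, this]
  have hΦ2 : ∀ ω, Measurable fun q : (ι × κ → ℝ) × (ρ → ℝ) => Φ q.1 ω q.2 := fun ω =>
    hmeas.comp (measurable_fst.prodMk (measurable_const.prodMk measurable_snd))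
  have hN : ∀ (G : Matrix ρ κ ℝ) (g : ρ → ℝ), (Gᵀ *ᵥ ((G * Gᵀ)⁻¹ *ᵥ g)) ⬝ᵥ
      (Gᵀ *ᵥ ((G * Gᵀ)⁻¹ *ᵥ g)) = g ⬝ᵥ ((G * Gᵀ)⁻¹ *ᵥ g) := by
    intro G g
    by_cases hu : IsUnit (G * Gᵀ).det
    · rw [dotProduct_mulVec, vecMul_transpose, mulVec_mulVec, mulVec_mulVec, mul_nonsing_inv _ hu,
        one_mulVec]
    · simp [nonsing_inv_apply_not_isUnit _ hu]
  rw [← hmp.lintegral_comp hdiag]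
  calc _ ≤ ∫⁻ ω, ∫⁻ ω', ∫⁻ g, Φ ω' ω g ∂(piGaussian ρ) ∂(piGaussian (ι × κ))
          ∂(piGaussian (ι × κ)) := by
        refine (lintegral_prod_le _).trans_eq ?_
        simp only [hmerge]
    _ = ∫⁻ ω, ∫⁻ g, ∫⁻ ω', Φ ω' ω g ∂(piGaussian (ι × κ)) ∂(piGaussian ρ)
          ∂(piGaussian (ι × κ)) := by
        refine lintegral_congr fun ω => ?_
        exact lintegral_lintegral_swap (hΦ2 ω).aemeasurable
    _ ≤ ∫⁻ ω : ι × κ → ℝ, ∫⁻ g, ENNReal.ofReal (g ⬝ᵥ (((Matrix.of fun i j => ω (f i, j)) *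
          (Matrix.of fun i j => ω (f i, j))ᵀ : Matrix ρ ρ ℝ)⁻¹ *ᵥ g)) ^ a * ENNReal.ofReal C1
          ∂(piGaussian ρ) ∂(piGaussian (ι × κ)) := by
        refine lintegral_mono fun ω => lintegral_mono fun g => ?_
        simp only [hΦ]
        rw [← hN]
        exact lintegral_mulVec_le c hc s hs0 hs a _
    _ = ∫⁻ g, ∫⁻ ω : ι × κ → ℝ, ENNReal.ofReal (g ⬝ᵥ (((Matrix.of fun i j => ω (f i, j)) *
          (Matrix.of fun i j => ω (f i, j))ᵀ : Matrix ρ ρ ℝ)⁻¹ *ᵥ g)) ^ a * ENNReal.ofReal C1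
          ∂(piGaussian (ι × κ)) ∂(piGaussian ρ) := by
        refine lintegral_lintegral_swap (Measurable.aemeasurable ?_)
        refine ((ENNReal.measurable_ofReal.comp (Finset.measurable_sum _ fun j _ =>
          Measurable.mul (by fun_prop) (measurable_mulVec_apply (fun i l => ?_) (fun l => ?_)
            j))).pow_const a).mul_const _
        · exact (hinv i l).comp measurable_fst
        · fun_prop
    _ ≤ ∫⁻ g, ENNReal.ofReal (g ⬝ᵥ g) ^ a * ENNReal.ofReal C2 * ENNReal.ofReal C1
          ∂(piGaussian ρ) := by
        refine lintegral_mono fun g => ?_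
        simp only []
        rw [lintegral_mul_const' _ _ ENNReal.ofReal_ne_top]
        gcongr
        refine le_trans (le_of_eq ?_) (lintegral_dotProduct_inv_gram_pow_le (κ := κ) ha hd g)
        have hm : Measurable fun ω : ρ × κ → ℝ =>
            ENNReal.ofReal (g ⬝ᵥ (((Matrix.of fun i j => ω (i, j)) *
            (Matrix.of fun i j => ω (i, j))ᵀ : Matrix ρ ρ ℝ)⁻¹ *ᵥ g)) ^ a := by
          refine (ENNReal.measurable_ofReal.comp (Finset.measurable_sum _ fun j _ =>
            measurable_const.mul (measurable_mulVec_apply (fun i l => ?_) (fun l => ?_)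
              j))).pow_const a
          · exact measurable_inv_gram i l
          · fun_prop
        exact hG.lintegral_comp hm
    _ ≤ ENNReal.ofReal C3 * ENNReal.ofReal C2 * ENNReal.ofReal C1 := by
        rw [lintegral_mul_const' _ _ ENNReal.ofReal_ne_top,
          lintegral_mul_const' _ _ ENNReal.ofReal_ne_top]
        gcongr
        have := lintegral_sum_mul_sq_pow_le (ι := ρ) (fun _ => 1) (fun _ => zero_le_one) 1
          zero_le_one (fun _ => le_rfl) a
        simpa [dotProduct, sq, C3] using this
    _ = _ := by
        have h2 : 0 ≤ C2 := Finset.prod_nonneg fun l hl => by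
          have hl' : l + 1 ≤ a := Finset.mem_range.mp hl
          have : ((2 * (l + 1) : ℕ) : ℝ) ≤ d := by exact_mod_cast (by omega)
          push_cast at this
          exact inv_nonneg.mpr (by linarith)
        have h3 : 0 ≤ C3 := Finset.prod_nonneg fun l hl => by positivity
        rw [ENNReal.ofReal_mul (by positivity), ENNReal.ofReal_mul h3]

theorem dotProduct_sq_le (v w : ι → ℝ) : (v ⬝ᵥ w) ^ 2 ≤ (v ⬝ᵥ v) * (w ⬝ᵥ w) := by
  simpa [dotProduct, sq] using Finset.sum_mul_sq_le_sq_mul_sq Finset.univ v w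

theorem dotProduct_self_nonneg' (v : ι → ℝ) : 0 ≤ v ⬝ᵥ v :=
  Finset.sum_nonneg fun i _ => mul_self_nonneg (v i)

/-- A Gaussian moment bound on `‖T g‖` controls the operator norm of `T`. -/
theorem dotProduct_mulVec_self_le_of_lintegral_le (T : Matrix ι κ ℝ) {t : ℝ} {a : ℕ} (ha : a ≠ 0)
    (h : ∫⁻ g, ENNReal.ofReal ((T *ᵥ g) ⬝ᵥ (T *ᵥ g)) ^ a ∂(piGaussian κ)
      ≤ ENNReal.ofReal ((∏ l ∈ Finset.range a, (2 * (l : ℝ) + 1)) * (t ^ 2) ^ a)) (x : κ → ℝ) :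
    (T *ᵥ x) ⬝ᵥ (T *ᵥ x) ≤ t ^ 2 * (x ⬝ᵥ x) := by
  set s := (T *ᵥ x) ⬝ᵥ (T *ᵥ x) with hs
  have hs0 : 0 ≤ s := dotProduct_self_nonneg' _
  set w := Tᵀ *ᵥ (T *ᵥ x)
  have hw : ∀ g, w ⬝ᵥ g = (T *ᵥ x) ⬝ᵥ (T *ᵥ g) := by
    intro g
    rw [dotProduct_mulVec, ← mulVec_transpose]
  set Q := ∏ l ∈ Finset.range a, (2 * (l : ℝ) + 1)
  have hQ : 0 < Q := Finset.prod_pos fun l _ => by positivity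
  have h1 : ENNReal.ofReal ((w ⬝ᵥ w) ^ a * Q) ≤ ENNReal.ofReal (s ^ a * (Q * (t ^ 2) ^ a)) := by
    rw [← lintegral_dotProduct_pow w a, ENNReal.ofReal_mul (by positivity), ENNReal.ofReal_pow hs0]
    refine le_trans ?_ (mul_le_mul_right h _)
    rw [← lintegral_const_mul' _ _ (ENNReal.pow_ne_top ENNReal.ofReal_ne_top)]
    refine lintegral_mono fun g => ?_
    simp only []
    rw [← mul_pow, ← ENNReal.ofReal_mul hs0]
    gcongr
    rw [hw]
    exact dotProduct_sq_le _ _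
  rw [ENNReal.ofReal_le_ofReal_iff (by positivity)] at h1
  have h2 : (w ⬝ᵥ w) ^ a ≤ (s * t ^ 2) ^ a := by
    rw [mul_pow]
    refine le_of_mul_le_mul_right ?_ hQ
    linarith
  have h3 : w ⬝ᵥ w ≤ s * t ^ 2 := le_of_pow_le_pow_left₀ ha (by positivity) h2
  have h4 : s ^ 2 ≤ (w ⬝ᵥ w) * (x ⬝ᵥ x) := by
    rw [hs, ← hw x]; exact dotProduct_sq_le _ _
  rcases hs0.eq_or_lt with h0 | h0
  · rw [← h0]; exact mul_nonneg (sq_nonneg _) (dotProduct_self_nonneg' _)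
  · have h5 : s * s ≤ s * (t ^ 2 * (x ⬝ᵥ x)) := by
      have := mul_le_mul_of_nonneg_right h3 (dotProduct_self_nonneg' x)
      linarith
    exact le_of_mul_le_mul_left h5 h0

theorem dotProduct_sub_mulVec_self_le [DecidableEq ι] {P : Matrix ι ι ℝ} (hP : P * P = P)
    (hPT : Pᵀ = P) (v : ι → ℝ) : (v - P *ᵥ v) ⬝ᵥ (v - P *ᵥ v) ≤ v ⬝ᵥ v := by
  have h1 : (P *ᵥ v) ⬝ᵥ (P *ᵥ v) = v ⬝ᵥ (P *ᵥ v) := by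
    rw [dotProduct_mulVec, ← mulVec_transpose, hPT, mulVec_mulVec, hP, dotProduct_comm]
  have h2 := dotProduct_self_nonneg' (P *ᵥ v)
  rw [sub_dotProduct, dotProduct_sub, dotProduct_sub, dotProduct_comm (P *ᵥ v) v, h1]
  linarith

theorem sum_mul_sub_sq_le {c y u : ι → ℝ} (hc : ∀ j, 0 ≤ c j) {α β : ℝ} (hα : 0 ≤ α) (hβ : 0 ≤ β)
    (hy : ∑ j, c j * y j ^ 2 ≤ α ^ 2) (hu : ∑ j, c j * u j ^ 2 ≤ β ^ 2) :
    ∑ j, c j * (y j - u j) ^ 2 ≤ (α + β) ^ 2 := by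
  have key : ∀ z : ι → ℝ, ‖(WithLp.toLp 2 fun j => √(c j) * z j : EuclideanSpace ℝ ι)‖ ^ 2
      = ∑ j, c j * z j ^ 2 := fun z => by
    rw [EuclideanSpace.real_norm_sq_eq]
    exact Finset.sum_congr rfl fun j _ => by simp [mul_pow, Real.sq_sqrt (hc j)]
  rw [← key] at hy hu
  have h1 := abs_le_of_sq_le_sq' hy hα |>.2
  have h2 := abs_le_of_sq_le_sq' hu hβ |>.2
  have h3 := key fun j => y j - u j
  rw [← h3]
  have h4 : (WithLp.toLp 2 fun j => √(c j) * (y j - u j) : EuclideanSpace ℝ ι)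
      = WithLp.toLp 2 (fun j => √(c j) * y j) - WithLp.toLp 2 (fun j => √(c j) * u j) := by
    ext j; simp [mul_sub]
  rw [h4]
  gcongr
  exact (norm_sub_le _ _).trans (add_le_add h1 h2)

/-- Deterministic error bound for the range finder, in coordinates where the quadratic form
`‖A y‖²` is diagonal. -/
theorem dotProduct_residual_le {ν ρ : Type*} [Fintype ν] [DecidableEq ν] [Fintype ρ]
    [DecidableEq ρ] [DecidableEq ι]
    {f : ρ → ι} (hf : Function.Injective f) {A : Matrix ν ι ℝ} {s c : ι → ℝ}
    (hA : ∀ y, (A *ᵥ y) ⬝ᵥ (A *ᵥ y) = ∑ j, s j * y j ^ 2)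
    (hc : ∀ j, 0 ≤ c j) (hcs : ∀ j, j ∉ Set.range f → c j = s j)
    {S t : ℝ} (hS : 0 ≤ S) (ht : 0 ≤ t) (hcS : ∀ j, c j ≤ S ^ 2)
    {Ω : Matrix ι κ ℝ} {G : Matrix ρ κ ℝ} (hG : ∀ i, G i = Ω (f i)) (hu : IsUnit (G * Gᵀ).det)
    (hT : ∀ x, ∑ j, c j * (Ω *ᵥ (Gᵀ *ᵥ ((G * Gᵀ)⁻¹ *ᵥ x))) j ^ 2 ≤ t ^ 2 * (x ⬝ᵥ x))
    {P : Matrix ν ν ℝ} (hP : P * P = P) (hPT : Pᵀ = P)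
    (hPA : ∀ z, P *ᵥ (A *ᵥ (Ω *ᵥ z)) = A *ᵥ (Ω *ᵥ z)) (y : ι → ℝ) :
    (A *ᵥ y - P *ᵥ (A *ᵥ y)) ⬝ᵥ (A *ᵥ y - P *ᵥ (A *ᵥ y)) ≤ (S + t) ^ 2 * (y ⬝ᵥ y) := by
  have hy0 := dotProduct_self_nonneg' y
  set x : ρ → ℝ := y ∘ f
  set z := Gᵀ *ᵥ ((G * Gᵀ)⁻¹ *ᵥ x) with hz
  set u := Ω *ᵥ z with hu'
  have huf : ∀ i, u (f i) = y (f i) := by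
    intro i
    have h1 : G *ᵥ z = x := by
      rw [hz, mulVec_mulVec, mulVec_mulVec, mul_nonsing_inv _ hu, one_mulVec]
    have h2 := congrFun h1 i
    rw [mulVec, hG] at h2
    exact h2
  have h1 : A *ᵥ y - P *ᵥ (A *ᵥ y) = A *ᵥ (y - u) - P *ᵥ (A *ᵥ (y - u)) := by
    rw [mulVec_sub, mulVec_sub, hPA z]
    abel
  have hx : x ⬝ᵥ x ≤ y ⬝ᵥ y := by
    simp only [dotProduct, x, Function.comp]
    rw [← Finset.sum_image (s := Finset.univ) (g := f) (f := fun j => y j * y j) hf.injOn]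
    exact Finset.sum_le_sum_of_subset_of_nonneg (Finset.subset_univ _)
      fun j _ _ => mul_self_nonneg _
  have h2 : ∑ j, s j * (y - u) j ^ 2 = ∑ j, c j * (y j - u j) ^ 2 := by
    refine Finset.sum_congr rfl fun j _ => ?_
    by_cases hj : j ∈ Set.range f
    · obtain ⟨i, rfl⟩ := hj
      simp [huf]
    · rw [hcs j hj, Pi.sub_apply]
  have hsq : √(y ⬝ᵥ y) ^ 2 = y ⬝ᵥ y := Real.sq_sqrt hy0
  have h3 : ∑ j, c j * (y j - u j) ^ 2 ≤ (S * √(y ⬝ᵥ y) + t * √(y ⬝ᵥ y)) ^ 2 := by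
    refine sum_mul_sub_sq_le hc (by positivity) (by positivity) ?_ ?_
    · rw [mul_pow, hsq, dotProduct, Finset.mul_sum]
      refine Finset.sum_le_sum fun j _ => ?_
      rw [← sq]
      exact mul_le_mul_of_nonneg_right (hcS j) (sq_nonneg _)
    · rw [mul_pow, hsq]
      exact (hT x).trans (mul_le_mul_of_nonneg_left hx (sq_nonneg _))
  rw [h1]
  refine (dotProduct_sub_mulVec_self_le hP hPT _).trans ?_
  rw [hA, h2]
  refine h3.trans_eq ?_
  rw [← add_mul, mul_pow, hsq]

/-- With high probability the Gaussian sketch `G` of the leading rows is invertible, and the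
trailing rows, multiplied by its pseudo-inverse, form an operator of norm at most `t`. -/
theorem ofReal_one_sub_le_piGaussian_sketch {ρ : Type*} [Fintype ρ] [DecidableEq ρ] {f : ρ → ι}
    (hf : Function.Injective f) {c : ι → ℝ} (hc : ∀ i, 0 ≤ c i) (hcf : ∀ i, c (f i) = 0) {s : ℝ}
    (hs0 : 0 ≤ s) (hs : ∀ i, c i ≤ s) {d a : ℕ} (ha0 : a ≠ 0) (ha : 2 * a < d)
    (hd : d + Fintype.card ρ ≤ Fintype.card κ + 1) {t q : ℝ} (hq : 0 ≤ q)
    (hb : (∏ l ∈ Finset.range a, ((Fintype.card ρ : ℝ) + 2 * l)) *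
        (∏ l ∈ Finset.range a, ((d : ℝ) - 2 * (l + 1))⁻¹) *
        ∏ l ∈ Finset.range a, (∑ j, c j + 2 * l * s)
      ≤ q * ((∏ l ∈ Finset.range a, (2 * (l : ℝ) + 1)) * (t ^ 2) ^ a)) :
    ENNReal.ofReal (1 - q) ≤ piGaussian (ι × κ) {ω |
      IsUnit ((Matrix.of fun i j => ω (f i, j)) *
        (Matrix.of fun i j => ω (f i, j))ᵀ : Matrix ρ ρ ℝ).det ∧
      ∀ x, ∑ j, c j * ((Matrix.of fun i j => ω (i, j)) *ᵥ
      ((Matrix.of fun i j => ω (f i, j))ᵀ *ᵥ (((Matrix.of fun i j => ω (f i, j)) *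
        (Matrix.of fun i j => ω (f i, j))ᵀ : Matrix ρ ρ ℝ)⁻¹ *ᵥ x))) j ^ 2
          ≤ t ^ 2 * (x ⬝ᵥ x)} := by
  classical
  let Φ : (ι × κ → ℝ) → (ι × κ → ℝ) → (ρ → ℝ) → ENNReal := fun ω' ω g =>
    ENNReal.ofReal (∑ j, c j * ((Matrix.of fun i j => ω' (i, j)) *ᵥ
      ((Matrix.of fun i j => ω (f i, j))ᵀ *ᵥ (((Matrix.of fun i j => ω (f i, j)) *
        (Matrix.of fun i j => ω (f i, j))ᵀ : Matrix ρ ρ ℝ)⁻¹ *ᵥ g))) j ^ 2) ^ a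
  obtain ⟨hF, hEF⟩ := lintegral_lintegral_sketch_le (κ := κ) hf hc hcf hs0 hs ha hd
    (Φ := Φ) fun _ _ _ => rfl
  set F := fun ω => ∫⁻ g, Φ ω ω g ∂(piGaussian ρ) with hFdef
  set τ := (∏ l ∈ Finset.range a, (2 * (l : ℝ) + 1)) * (t ^ 2) ^ a
  have hτ : 0 ≤ τ := mul_nonneg (Finset.prod_nonneg fun l _ => by positivity) (by positivity)
  have hEF' : ∫⁻ ω, F ω ∂(piGaussian (ι × κ)) ≤ ENNReal.ofReal (q * τ) :=
    hEF.trans (ENNReal.ofReal_le_ofReal hb)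
  have hmarkov : piGaussian (ι × κ) {ω | ENNReal.ofReal τ < F ω} ≤ ENNReal.ofReal q := by
    rcases hτ.eq_or_lt with h0 | h0
    · rw [← h0, mul_zero, ENNReal.ofReal_zero, nonpos_iff_eq_zero, lintegral_eq_zero_iff hF] at hEF'
      have : piGaussian (ι × κ) {ω | ENNReal.ofReal τ < F ω} = 0 := by
        refine measure_mono_null (fun ω hω => ?_) (ae_iff.mp hEF')
        exact (ne_bot_of_gt hω : F ω ≠ 0)
      rw [this]; exact bot_le
    · have h1 := mul_meas_ge_le_lintegral (μ := piGaussian (ι × κ)) hF (ENNReal.ofReal τ)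
      have h2 := h1.trans hEF'
      rw [mul_comm q, ENNReal.ofReal_mul hτ,
        ENNReal.mul_le_mul_iff_right (by simpa using h0) ENNReal.ofReal_ne_top] at h2
      refine le_trans (measure_mono fun ω hω => ?_) h2
      exact le_of_lt (show ENNReal.ofReal τ < F ω from hω)
  have hfi : Function.Injective (Prod.map f (id : κ → κ)) := hf.prodMap Function.injective_id
  have hG := measurePreserving_comp_piGaussian hfi
  have hinv : ∀ᵐ ω ∂(piGaussian (ι × κ)), IsUnit ((Matrix.of fun i j => ω (f i, j)) *
        (Matrix.of fun i j => ω (f i, j))ᵀ : Matrix ρ ρ ℝ).det :=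
    hG.quasiMeasurePreserving.ae (ae_isUnit_det_gram (by omega))
  set E := {ω : ι × κ → ℝ | IsUnit ((Matrix.of fun i j => ω (f i, j)) *
        (Matrix.of fun i j => ω (f i, j))ᵀ : Matrix ρ ρ ℝ).det ∧ F ω ≤ ENNReal.ofReal τ} with hE
  have hEc : piGaussian (ι × κ) Eᶜ ≤ ENNReal.ofReal q := by
    refine le_trans (measure_mono_ae ?_) hmarkov
    filter_upwards [hinv] with ω hω hωE
    exact not_le.mp fun h => hωE ⟨hω, h⟩
  have hE1 : ENNReal.ofReal (1 - q) ≤ piGaussian (ι × κ) E := by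
    rw [ENNReal.ofReal_sub _ hq, ENNReal.ofReal_one, tsub_le_iff_right]
    calc 1 = piGaussian (ι × κ) (E ∪ Eᶜ) := by rw [Set.union_compl_self, measure_univ]
      _ ≤ _ := (measure_union_le _ _).trans (by gcongr)
  refine hE1.trans (measure_mono ?_)
  rintro ω ⟨hω1, hω2⟩
  refine ⟨hω1, fun x => ?_⟩
  set G : Matrix ρ κ ℝ := Matrix.of fun i j => ω (f i, j)
  set O : Matrix ι κ ℝ := Matrix.of fun i j => ω (i, j)
  let T : Matrix ι ρ ℝ := diagonal (fun j => √(c j)) * (O * (Gᵀ * (G * Gᵀ)⁻¹))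
  have hT : ∀ g, (T *ᵥ g) ⬝ᵥ (T *ᵥ g)
      = ∑ j, c j * (O *ᵥ (Gᵀ *ᵥ ((G * Gᵀ)⁻¹ *ᵥ g))) j ^ 2 := by
    intro g
    refine Finset.sum_congr rfl fun j _ => ?_
    simp only [T, ← mulVec_mulVec, mulVec_diagonal]
    rw [← sq, mul_pow, Real.sq_sqrt (hc j)]
  rw [← hT]
  refine dotProduct_mulVec_self_le_of_lintegral_le T ha0 (le_trans (le_of_eq ?_) hω2) x
  exact lintegral_congr fun g => by rw [hT]

end

theorem exp_four_le : Real.exp 4 ≤ 54.6 := by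
  have h : Real.exp 4 = Real.exp 1 ^ 4 := by rw [← Real.exp_nat_mul]; norm_num
  rw [h]
  calc Real.exp 1 ^ 4 ≤ 2.7182818286 ^ 4 := by gcongr; exact Real.exp_one_lt_d9.le
    _ ≤ 54.6 := by norm_num

theorem exp_five_le : Real.exp 5 ≤ 149 := by
  have h : Real.exp 5 = Real.exp 1 ^ 5 := by rw [← Real.exp_nat_mul]; norm_num
  rw [h]
  calc Real.exp 1 ^ 5 ≤ 2.7182818286 ^ 5 := by gcongr; exact Real.exp_one_lt_d9.le
    _ ≤ 149 := by norm_num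

theorem add_two_pow_le {N : ℕ} (hN : 0 < N) :
    ((N : ℝ) + 2) ^ N ≤ Real.exp 2 * (N : ℝ) ^ N := by
  have hN' : (0 : ℝ) < N := by exact_mod_cast hN
  have h1 : (N : ℝ) + 2 ≤ Real.exp (2 / N) * N := by
    have := mul_le_mul_of_nonneg_right (Real.add_one_le_exp (2 / (N : ℝ))) hN'.le
    refine le_trans (le_of_eq ?_) this
    field_simp
    ring
  calc ((N : ℝ) + 2) ^ N ≤ (Real.exp (2 / N) * N) ^ N := by gcongr
    _ = Real.exp 2 * (N : ℝ) ^ N := by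
      rw [mul_pow, ← Real.exp_nat_mul]
      congr 2
      field_simp

theorem exp_mul_pow_le_of_even {a : ℕ} (ha : 2 ≤ a) :
    Real.exp (2 * a) * (2 * a + 1 : ℝ) ^ (2 * a) * (2 * a + 8)
      ≤ 6 * (2 * a + 1) * 64 ^ a * (∏ l ∈ Finset.range a, (2 * (l : ℝ) + 1)) ^ 2 := by
  induction a, ha using Nat.le_induction with
  | base =>
    have := exp_four_le
    norm_num [Finset.prod_range_succ] at this ⊢
    linarith
  | succ a ha ih =>
    have ha' : (2 : ℝ) ≤ a := by exact_mod_cast ha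
    have hY := add_two_pow_le (N := 2 * a + 1) (by omega)
    rw [Finset.prod_range_succ]
    set O := ∏ l ∈ Finset.range a, (2 * (l : ℝ) + 1)
    push_cast at hY ⊢
    set x : ℝ := 2 * a + 1 with hx
    have hx0 : 0 < x := by positivity
    have e1 : Real.exp (2 * ((a : ℝ) + 1)) = Real.exp (2 * a) * Real.exp 2 := by
      rw [← Real.exp_add]; ring_nf
    have e2 : Real.exp 2 * Real.exp 2 = Real.exp 4 := by rw [← Real.exp_add]; norm_num
    have e3 : 2 * ((a : ℝ) + 1) + 1 = x + 2 := by rw [hx]; ring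
    have e4 : 2 * ((a : ℝ) + 1) + 8 = x + 9 := by rw [hx]; ring
    have e5 : 2 * (a : ℝ) + 8 = x + 7 := by rw [hx]; ring
    rw [e5] at ih
    rw [e1, e3, e4, show 2 * (a + 1) = 2 * a + 1 + 1 by ring, pow_succ (x + 2)]
    have h54 : Real.exp 4 * (x + 9) ≤ 64 * (x + 7) := by
      have := mul_le_mul_of_nonneg_right exp_four_le (by positivity : 0 ≤ x + 9)
      have : (5 : ℝ) ≤ x := by rw [hx]; linarith
      linarith
    calc Real.exp (2 * a) * Real.exp 2 * ((x + 2) ^ (2 * a + 1) * (x + 2)) * (x + 9)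
        ≤ Real.exp (2 * a) * Real.exp 2 * ((Real.exp 2 * x ^ (2 * a + 1)) * (x + 2)) * (x + 9) := by
          gcongr
      _ = (Real.exp (2 * a) * x ^ (2 * a) * x * (x + 2)) *
            ((Real.exp 2 * Real.exp 2) * (x + 9)) := by ring
      _ ≤ (Real.exp (2 * a) * x ^ (2 * a) * x * (x + 2)) * (64 * (x + 7)) := by
          rw [e2]; gcongr
      _ = (Real.exp (2 * a) * x ^ (2 * a) * (x + 7)) * (64 * x * (x + 2)) := by ring
      _ ≤ (6 * x * 64 ^ a * O ^ 2) * (64 * x * (x + 2)) := by gcongr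
      _ = _ := by ring

theorem exp_mul_pow_le_of_odd {a : ℕ} (ha : 2 ≤ a) :
    Real.exp (2 * a + 1) * (2 * a + 2 : ℝ) ^ (2 * a) * (2 * a + 2)
      ≤ 6 * (2 * a + 1) * 64 ^ a * ((∏ l ∈ Finset.range a, (2 * (l : ℝ) + 1)) *
        ∏ l ∈ Finset.range a, (2 * (l : ℝ) + 2)) := by
  induction a, ha using Nat.le_induction with
  | base =>
    have := exp_five_le
    norm_num [Finset.prod_range_succ] at this ⊢
    linarith
  | succ a ha ih =>
    have ha' : (2 : ℝ) ≤ a := by exact_mod_cast ha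
    have hY := add_two_pow_le (N := 2 * a + 2) (by omega)
    rw [Finset.prod_range_succ, Finset.prod_range_succ]
    set O := ∏ l ∈ Finset.range a, (2 * (l : ℝ) + 1)
    set D := ∏ l ∈ Finset.range a, (2 * (l : ℝ) + 2)
    push_cast at hY ⊢
    have e5 : 2 * (a : ℝ) + 1 = 2 * a + 2 - 1 := by ring
    have e1 : Real.exp (2 * ((a : ℝ) + 1) + 1) = Real.exp (2 * a + 1) * Real.exp 2 := by
      rw [← Real.exp_add]; ring_nf
    set w := Real.exp (2 * (a : ℝ) + 1)
    rw [e5] at ih ⊢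
    set y : ℝ := 2 * a + 2 with hy
    have hy6 : (6 : ℝ) ≤ y := by rw [hy]; linarith
    have hy0 : 0 < y := by positivity
    have hy1 : 0 ≤ y - 1 := by linarith
    have e2 : Real.exp 2 * Real.exp 2 = Real.exp 4 := by rw [← Real.exp_add]; norm_num
    have e3 : 2 * ((a : ℝ) + 1) + 1 = y + 1 := by rw [hy]; ring
    have e4 : 2 * ((a : ℝ) + 1) + 2 = y + 2 := by rw [hy]; ring
    rw [e1, e3, e4, show 2 * (a + 1) = 2 * a + 2 by ring]
    have h54 : Real.exp 4 * (y + 2) ≤ 64 * (y + 1) := by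
      have := mul_le_mul_of_nonneg_right exp_four_le (by positivity : 0 ≤ y + 2)
      linarith
    have hw : 0 < w := Real.exp_pos _
    calc w * Real.exp 2 * (y + 2) ^ (2 * a + 2) * (y + 2)
        ≤ w * Real.exp 2 * (Real.exp 2 * y ^ (2 * a + 2)) * (y + 2) := by
          gcongr
      _ = (w * y ^ (2 * a) * y ^ 2) * ((Real.exp 2 * Real.exp 2) * (y + 2)) := by ring
      _ ≤ (w * y ^ (2 * a) * y ^ 2) * (64 * (y + 1)) := by
          rw [e2]; gcongr
      _ = (w * y ^ (2 * a) * y) * (64 * y * (y + 1)) := by ring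
      _ ≤ (6 * (y - 1) * 64 ^ a * (O * D)) * (64 * y * (y + 1)) := by gcongr
      _ = _ := by ring

theorem exp_mul_succ_sq_pow_le {p : ℕ} (hp : 4 ≤ p) :
    Real.exp p * (((p : ℝ) + 1) ^ 2) ^ (p / 2) ≤
      6 * 64 ^ (p / 2) * ((∏ l ∈ Finset.range (p / 2), (2 * (l : ℝ) + 1)) *
        ∏ l ∈ Finset.range (p / 2), (((p + 1 : ℕ) : ℝ) - 2 * (l + 1))) := by
  obtain ⟨a, rfl | rfl⟩ := Nat.even_or_odd' p
  · have h2 : 2 * a / 2 = a := by omega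
    have hD : ∏ l ∈ Finset.range a, (((2 * a + 1 : ℕ) : ℝ) - 2 * (l + 1))
        = ∏ l ∈ Finset.range a, (2 * (l : ℝ) + 1) := by
      rw [← Finset.prod_range_reflect]
      refine Finset.prod_congr rfl fun l hl => ?_
      have := Finset.mem_range.mp hl
      rw [show a - 1 - l = a - (l + 1) by omega, Nat.cast_sub (by omega)]
      push_cast; ring
    have h := exp_mul_pow_le_of_even (a := a) (by omega)
    rw [h2, hD, ← pow_mul]
    push_cast
    set O := ∏ l ∈ Finset.range a, (2 * (l : ℝ) + 1)
    have hpos : (0 : ℝ) < 2 * a + 8 := by positivity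
    refine le_of_mul_le_mul_right (h.trans ?_) hpos
    calc 6 * (2 * (a : ℝ) + 1) * 64 ^ a * O ^ 2 ≤ 6 * (2 * (a : ℝ) + 8) * 64 ^ a * O ^ 2 := by
          gcongr; norm_num
      _ = _ := by ring
  · have h2 : (2 * a + 1) / 2 = a := by omega
    have hD : ∏ l ∈ Finset.range a, (((2 * a + 1 + 1 : ℕ) : ℝ) - 2 * (l + 1))
        = ∏ l ∈ Finset.range a, (2 * (l : ℝ) + 2) := by
      rw [← Finset.prod_range_reflect]
      refine Finset.prod_congr rfl fun l hl => ?_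
      have := Finset.mem_range.mp hl
      rw [show a - 1 - l = a - (l + 1) by omega, Nat.cast_sub (by omega)]
      push_cast; ring
    have h := exp_mul_pow_le_of_odd (a := a) (by omega)
    rw [h2, hD, ← pow_mul]
    push_cast
    rw [show 2 * (a : ℝ) + 1 + 1 = 2 * a + 2 by ring]
    set O := ∏ l ∈ Finset.range a, (2 * (l : ℝ) + 1) with hO
    set D := ∏ l ∈ Finset.range a, (2 * (l : ℝ) + 2) with hD
    have hO0 : 0 ≤ O := Finset.prod_nonneg fun l _ => by positivity
    have hD0 : 0 ≤ D := Finset.prod_nonneg fun l _ => by positivity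
    have hpos : (0 : ℝ) < 2 * a + 2 := by positivity
    refine le_of_mul_le_mul_right (h.trans ?_) hpos
    calc 6 * (2 * (a : ℝ) + 1) * 64 ^ a * (O * D) ≤ 6 * (2 * (a : ℝ) + 2) * 64 ^ a * (O * D) := by
          gcongr; norm_num
      _ = _ := by ring

theorem prod_le_exp_mul_error_pow {r p : ℕ} (hp : 4 ≤ p) {σ S : ℝ} (hσ : 0 ≤ σ) (hS : 0 ≤ S) :
    (∏ l ∈ Finset.range (p / 2), ((r : ℝ) + 2 * l)) *
        (∏ l ∈ Finset.range (p / 2), (((p + 1 : ℕ) : ℝ) - 2 * (l + 1))⁻¹) *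
        ∏ l ∈ Finset.range (p / 2), (S ^ 2 + 2 * l * σ ^ 2)
      ≤ 6 * Real.exp (-(p : ℝ)) * ((∏ l ∈ Finset.range (p / 2), (2 * (l : ℝ) + 1)) *
        ((17 * √(1 + (r : ℝ) / p) * σ + 8 * √((r : ℝ) + p) / (p + 1) * S) ^ 2) ^ (p / 2)) := by
  have hnum := exp_mul_succ_sq_pow_le hp
  rw [Finset.prod_inv_distrib]
  set a := p / 2 with ha
  have hp0 : (0 : ℝ) < p := by exact_mod_cast (by omega : 0 < p)
  have h2l : ∀ l ∈ Finset.range a, 2 * (l : ℝ) ≤ p ∧ 0 < ((p + 1 : ℕ) : ℝ) - 2 * (l + 1) := by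
    intro l hl
    have h1 := Finset.mem_range.mp hl
    have h3 : 2 * (l + 1) < p + 1 := by omega
    have h4 : (((2 * (l + 1) : ℕ)) : ℝ) < ((p + 1 : ℕ) : ℝ) := by exact_mod_cast h3
    push_cast at h4 ⊢
    constructor <;> linarith
  set O := ∏ l ∈ Finset.range a, (2 * (l : ℝ) + 1)
  set D := ∏ l ∈ Finset.range a, (((p + 1 : ℕ) : ℝ) - 2 * (l + 1))
  have hO : 0 < O := Finset.prod_pos fun l _ => by positivity
  have hD : 0 < D := Finset.prod_pos fun l hl => (h2l l hl).2
  have h1 : ∏ l ∈ Finset.range a, ((r : ℝ) + 2 * l) ≤ ((r : ℝ) + p) ^ a := by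
    refine (Finset.prod_le_prod (fun l _ => by positivity)
      fun l hl => add_le_add_right (h2l l hl).1 _).trans_eq ?_
    simp
  have h3 : ∏ l ∈ Finset.range a, (S ^ 2 + 2 * l * σ ^ 2) ≤ ((S + √p * σ) ^ 2) ^ a := by
    refine (Finset.prod_le_prod (g := fun _ => (S + √p * σ) ^ 2) (fun l _ => by positivity)
      fun l hl => ?_).trans_eq (by simp)
    have e1 : (S + √p * σ) ^ 2 = S ^ 2 + 2 * S * √p * σ + √(p : ℝ) ^ 2 * σ ^ 2 := by ring
    rw [e1, Real.sq_sqrt hp0.le]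
    have e2 := mul_le_mul_of_nonneg_right (h2l l hl).1 (sq_nonneg σ)
    have e3 : 0 ≤ 2 * S * √p * σ := by positivity
    linarith
  have h4 : 8 * √((r : ℝ) + p) / (p + 1) * (S + √p * σ) ≤
      17 * √(1 + (r : ℝ) / p) * σ + 8 * √((r : ℝ) + p) / (p + 1) * S := by
    have e1 : √(1 + (r : ℝ) / p) = √((r : ℝ) + p) / √p := by
      rw [← Real.sqrt_div' _ hp0.le]
      congr 1
      field_simp
      ring
    have e2 : 8 * √((r : ℝ) + p) / (p + 1) * √p ≤ 17 * (√((r : ℝ) + p) / √p) := by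
      have hsp : 0 < √(p : ℝ) := Real.sqrt_pos.mpr hp0
      rw [mul_div_assoc', div_mul_eq_mul_div, div_le_div_iff₀ (by positivity) hsp]
      have e3 : √(p : ℝ) * √p = p := Real.mul_self_sqrt hp0.le
      have e4 : 0 ≤ √((r : ℝ) + p) := Real.sqrt_nonneg _
      nlinarith [mul_nonneg e4 hp0.le]
    have e5 := mul_le_mul_of_nonneg_right e2 hσ
    rw [e1]
    linarith
  have h5 : ((8 * √((r : ℝ) + p) / (p + 1) * (S + √p * σ)) ^ 2) ^ a
      = 64 ^ a * ((r : ℝ) + p) ^ a * ((S + √p * σ) ^ 2) ^ a / (((p : ℝ) + 1) ^ 2) ^ a := by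
    rw [← mul_pow, ← mul_pow, ← div_pow]
    congr 1
    rw [mul_pow, div_pow, mul_pow, Real.sq_sqrt (by positivity)]
    ring
  calc _ ≤ ((r : ℝ) + p) ^ a * D⁻¹ * ((S + √p * σ) ^ 2) ^ a := by
        have : 0 ≤ ∏ l ∈ Finset.range a, (S ^ 2 + 2 * l * σ ^ 2) :=
          Finset.prod_nonneg fun l _ => by positivity
        gcongr
    _ ≤ 6 * Real.exp (-(p : ℝ)) * (O *
          (64 ^ a * ((r : ℝ) + p) ^ a * ((S + √p * σ) ^ 2) ^ a / (((p : ℝ) + 1) ^ 2) ^ a)) := by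
        set K := ((r : ℝ) + p) ^ a * ((S + √p * σ) ^ 2) ^ a
        have hK : 0 ≤ K := by positivity
        set Y := (((p : ℝ) + 1) ^ 2) ^ a
        have hY : 0 < Y := by positivity
        have key : D⁻¹ ≤ 6 * Real.exp (-(p : ℝ)) * O * 64 ^ a / Y := by
          rw [Real.exp_neg, inv_le_iff_one_le_mul₀ hD]
          have he := Real.exp_pos (p : ℝ)
          rw [div_mul_eq_mul_div, le_div_iff₀ hY, one_mul]
          have := (le_div_iff₀' he).mpr hnum
          refine this.trans_eq ?_
          field_simp
        calc _ = K * D⁻¹ := by ring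
          _ ≤ K * (6 * Real.exp (-(p : ℝ)) * O * 64 ^ a / Y) := by gcongr
          _ = _ := by ring
    _ ≤ _ := by
        rw [← h5]
        gcongr

theorem spectralNorm'_le {n m : ℕ} {A : Matrix (Fin n) (Fin m) ℝ} {C : ℝ} (hC : 0 ≤ C)
    (h : ∀ x, (A *ᵥ x) ⬝ᵥ (A *ᵥ x) ≤ C ^ 2 * (x ⬝ᵥ x)) : spectralNorm' A ≤ C := by
  refine ContinuousLinearMap.opNorm_le_bound _ hC fun x => ?_
  have key : ∀ {k : ℕ} (y : EuclideanSpace ℝ (Fin k)), ‖y‖ ^ 2 = y.ofLp ⬝ᵥ y.ofLp := fun y => by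
    rw [EuclideanSpace.real_norm_sq_eq]
    simp [dotProduct, sq]
  refine le_of_sq_le_sq ?_ (by positivity)
  rw [mul_pow, key, key]
  exact h x.ofLp

theorem exists_orthogonal_mulVec_dotProduct_eq {ι κ : Type*} [Fintype ι] [Fintype κ] [DecidableEq κ]
    {A : Matrix ι κ ℝ} (hA : (Aᵀ * A).IsHermitian) (e : κ ≃ κ) :
    ∃ V : Matrix κ κ ℝ, V * Vᵀ = 1 ∧
      ∀ y, ((A * V) *ᵥ y) ⬝ᵥ ((A * V) *ᵥ y) = ∑ j, hA.eigenvalues (e j) * y j ^ 2 := by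
  let V : Matrix κ κ ℝ := Matrix.of fun l i => hA.eigenvectorBasis (e i) l
  have hV : Vᵀ * V = 1 := by
    ext l l'
    have h := orthonormal_iff_ite.mp hA.eigenvectorBasis.orthonormal (e l') (e l)
    rw [EuclideanSpace.inner_eq_star_dotProduct, star_trivial] at h
    simpa [V, mul_apply, dotProduct, one_apply, eq_comm] using h
  refine ⟨V, mul_eq_one_comm.mp hV, fun y => ?_⟩
  have hAV : (Aᵀ * A) * V = V * diagonal fun j => hA.eigenvalues (e j) := by
    ext l j
    rw [mul_diagonal]
    have h := congrFun (hA.mulVec_eigenvectorBasis (e j)) l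
    simpa [V, mul_apply, mulVec, dotProduct, mul_comm] using h
  have hgram : (A * V)ᵀ * (A * V) = diagonal fun j => hA.eigenvalues (e j) := by
    rw [transpose_mul, Matrix.mul_assoc, ← Matrix.mul_assoc Aᵀ, hAV, ← Matrix.mul_assoc, hV,
      Matrix.one_mul]
  rw [dotProduct_mulVec, ← mulVec_transpose, mulVec_mulVec, hgram]
  refine Finset.sum_congr rfl fun j _ => ?_
  rw [mulVec_diagonal]
  ring

/-- Corollary 10.9 of Halko–Martinsson–Tropp: for a real `n × m` matrix `A` with singular
values `σ 0 ≥ σ 1 ≥ ⋯ ≥ 0` (the decreasingly ordered square roots of the eigenvalues of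
`AᵀA`, padded by zeros), target rank `r ≥ 1` and oversampling parameter `p ≥ 4` with
`k := r + p ≤ min{m,n}`, and `Ω` an `m × k` matrix with i.i.d. standard Gaussian entries,
with probability at least `1 − 6 e^{−p}` the orthogonal projection `P` onto the column
space of `AΩ` satisfies
`‖A − P A‖₂ ≤ (1 + 17 √(1 + r/p)) σ_{r+1} + (8√k/(p+1)) (∑_{j>r} σ_j²)^{1/2}`.
(Indices are 0-based: `σ r` is the `(r+1)`-st singular value.) -/
theorem randomized_svd_error_bound (n m r p : ℕ) (hr : 1 ≤ r) (hp : 4 ≤ p)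
    (hk : r + p ≤ min m n)
    (A : Matrix (Fin n) (Fin m) ℝ) (hA : (Aᵀ * A).IsHermitian)
    (σ : ℕ → ℝ) (hσ_anti : Antitone σ) (hσ_pad : ∀ j, m ≤ j → σ j = 0)
    (hσ_eig : ∃ e : Fin m ≃ Fin m, ∀ i : Fin m, σ (i : ℕ) = Real.sqrt (hA.eigenvalues (e i))) :
    ENNReal.ofReal (1 - 6 * Real.exp (-(p : ℝ))) ≤
      Measure.pi (fun _ : Fin m × Fin (r + p) => gaussianReal 0 1)
        {ω | ∀ P : Matrix (Fin n) (Fin n) ℝ,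
          P * P = P → Pᵀ = P →
          LinearMap.range (Matrix.toLin' P)
            = LinearMap.range (Matrix.toLin' (A * Matrix.of fun i j => ω (i, j))) →
          spectralNorm' (A - P * A)
            ≤ (1 + 17 * Real.sqrt (1 + (r : ℝ) / (p : ℝ))) * σ r
              + (8 * Real.sqrt ((r : ℝ) + (p : ℝ)) / ((p : ℝ) + 1))
                * Real.sqrt (∑ j ∈ Finset.Ico r m, σ j ^ 2)} := by
  obtain ⟨e, he⟩ := hσ_eig
  have hkm : r + p ≤ m := hk.trans (min_le_left _ _)
  have hrm : r ≤ m := by omega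
  have hσ0 : ∀ j, 0 ≤ σ j := by
    intro j
    rcases lt_or_ge j m with hj | hj
    · rw [he ⟨j, hj⟩]; exact Real.sqrt_nonneg _
    · rw [hσ_pad j hj]
  have hpsd : (Aᵀ * A).PosSemidef := by
    simpa using posSemidef_conjTranspose_mul_self A
  obtain ⟨V, hV, hAV⟩ := exists_orthogonal_mulVec_dotProduct_eq hA e
  have hV' : Vᵀ * V = 1 := mul_eq_one_comm.mp hV
  have hquad : ∀ y, ((A * V) *ᵥ y) ⬝ᵥ ((A * V) *ᵥ y) = ∑ j : Fin m, σ j ^ 2 * y j ^ 2 := by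
    intro y
    rw [hAV]
    refine Finset.sum_congr rfl fun j _ => ?_
    rw [he, Real.sq_sqrt (hpsd.eigenvalues_nonneg _)]
  let f : Fin r → Fin m := Fin.castLE hrm
  have hf : Function.Injective f := Fin.castLE_injective hrm
  let c : Fin m → ℝ := fun j => if (j : ℕ) < r then 0 else σ j ^ 2
  have hc : ∀ j, 0 ≤ c j := fun j => by
    simp only [c]; split_ifs <;> positivity
  have hcf : ∀ i, c (f i) = 0 := fun i => by simp [c, f]
  have hcσ : ∀ j ∉ Set.range f, c j = σ j ^ 2 := fun j hj => by
    refine if_neg fun h => hj ⟨⟨j, h⟩, rfl⟩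
  have hcs : ∀ j, c j ≤ σ r ^ 2 := fun j => by
    simp only [c]
    split_ifs with h
    · positivity
    · exact pow_le_pow_left₀ (hσ0 _) (hσ_anti (not_lt.mp h)) 2
  set S := √(∑ j ∈ Finset.Ico r m, σ j ^ 2) with hS
  have hsum : ∑ j, c j = S ^ 2 := by
    rw [hS, Real.sq_sqrt (Finset.sum_nonneg fun j _ => sq_nonneg _)]
    rw [Fin.sum_univ_eq_sum_range (fun j => if j < r then 0 else σ j ^ 2) m,
      Finset.range_eq_Ico, ← Finset.sum_Ico_consecutive _ (Nat.zero_le r) hrm,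
      Finset.sum_eq_zero fun j hj => if_pos (Finset.mem_Ico.mp hj).2, zero_add]
    exact Finset.sum_congr rfl fun j hj => if_neg (not_lt.mpr (Finset.mem_Ico.mp hj).1)
  set t := 17 * √(1 + (r : ℝ) / p) * σ r + 8 * √((r : ℝ) + p) / (p + 1) * S with ht
  have hσr := hσ0 r
  have ht0 : 0 ≤ t := by positivity
  have hprob := ofReal_one_sub_le_piGaussian_sketch (κ := Fin (r + p)) hf hc hcf
    (sq_nonneg (σ r)) hcs (d := p + 1) (a := p / 2) (by omega) (by omega)
    (by simp only [Fintype.card_fin]; omega) (t := t) (q := 6 * Real.exp (-(p : ℝ)))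
    (by positivity)
    (by
      rw [hsum, Fintype.card_fin]
      exact prod_le_exp_mul_error_pow hp hσr (Real.sqrt_nonneg _))
  refine hprob.trans ((measure_mono ?_).trans
    ((measurePreserving_mul_piGaussian V hV).measure_preimage_le _))
  rintro ω ⟨hu, hT⟩ P hP hPT hrange
  set Ω : Matrix (Fin m) (Fin (r + p)) ℝ := Matrix.of fun i j => ω (i, j) with hΩ
  have hVΩ : (Matrix.of fun i j => (fun q : Fin m × Fin (r + p) => (V * Ω) q.1 q.2) (i, j))
      = V * Ω := rfl
  rw [hVΩ] at hrange
  have hPA : ∀ z, P *ᵥ ((A * V) *ᵥ (Ω *ᵥ z)) = (A * V) *ᵥ (Ω *ᵥ z) := by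
    intro z
    have hmem : (A * V) *ᵥ (Ω *ᵥ z) ∈ LinearMap.range (Matrix.toLin' P) := by
      rw [hrange]
      exact ⟨z, by rw [toLin'_apply, mulVec_mulVec, Matrix.mul_assoc]⟩
    obtain ⟨w, hw⟩ := hmem
    rw [← hw, toLin'_apply, mulVec_mulVec, hP]
  have hbound : (1 + 17 * √(1 + (r : ℝ) / p)) * σ r + 8 * √((r : ℝ) + p) / (p + 1) * S
      = σ r + t := by rw [ht]; ring
  rw [hbound]
  refine spectralNorm'_le (by positivity) fun x => ?_
  have h := dotProduct_residual_le hf hquad hc hcσ hσr ht0 hcs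
    (G := Matrix.of fun i j => ω (f i, j)) (fun i => rfl) hu hT hP hPT hPA (Vᵀ *ᵥ x)
  have hx : (A * V) *ᵥ (Vᵀ *ᵥ x) = A *ᵥ x := by
    rw [mulVec_mulVec, Matrix.mul_assoc, hV, Matrix.mul_one]
  have hnorm : (Vᵀ *ᵥ x) ⬝ᵥ (Vᵀ *ᵥ x) = x ⬝ᵥ x := by
    rw [dotProduct_mulVec, vecMul_transpose, mulVec_mulVec, hV, one_mulVec]
  rw [hx, hnorm] at h
  rwa [sub_mulVec, ← mulVec_mulVec]
end

section
/- Let A be a real n×m matrix with singular values σ₁ ≥ σ₂ ≥ ⋯ ≥ 0, let r ≥ 1 with r + 5 ≤ min{m,n}, and let Ω be an m×(r+5) random matrix with independent standard Gaussian entries. Then with probability at least 0.998, the orthogonal projection P onto the column space of AΩ satisfies ‖A − P A‖₂ ≤ (1 + 11√(min{m,n}(r+5))) σ_{r+1}. -/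
open MeasureTheory ProbabilityTheory Matrix

section GaussianLaws

variable {E : Type*} [NormedAddCommGroup E] [InnerProductSpace ℝ E] [FiniteDimensional ℝ E]
  [MeasurableSpace E] [BorelSpace E]

lemma charFunDual_gaussianReal_zero_one (L : StrongDual ℝ ℝ) :
    charFunDual (gaussianReal 0 1) L = Complex.exp (-((L 1 ^ 2 : ℝ) : ℂ) / 2) := by
  rw [charFunDual_eq_charFun_map_one]
  have : ⇑L = fun x => L 1 * x := by
    ext x
    simpa [mul_comm] using L.map_smul x 1
  rw [this, gaussianReal_map_const_mul, charFun_gaussianReal]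
  simp
  ring_nf

/-- The coordinates of a standard Gaussian vector along an orthonormal family are independent
standard Gaussians. -/
lemma stdGaussian_map_inner_orthonormal {κ : Type*} [Fintype κ] {b : κ → E}
    (hb : Orthonormal ℝ b) :
    (stdGaussian E).map (fun x i => inner ℝ (b i) x) =
      Measure.pi fun _ : κ => gaussianReal 0 1 := by
  classical
  let T : E →L[ℝ] (κ → ℝ) := ContinuousLinearMap.pi fun i => innerSL ℝ (b i)
  have hT : (fun x i => inner ℝ (b i) x) = ⇑T := by ext; simp [T]
  rw [hT]
  apply Measure.ext_of_charFunDual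
  ext L
  rw [charFunDual_map, charFunDual_stdGaussian, charFunDual_pi]
  simp_rw [charFunDual_gaussianReal_zero_one, ← Complex.exp_sum]
  congr 1
  have h1 : L.comp T = innerSL ℝ (∑ i, L (Pi.single i 1) • b i) := by
    ext x
    have : T x = ∑ i, (inner ℝ (b i) x) • (Pi.single i (1 : ℝ) : κ → ℝ) := by
      ext j
      simp [T, Finset.sum_apply, Pi.single_apply]
    simp [this, mul_comm]
  rw [h1, innerSL_apply_norm, ← Complex.ofReal_pow, ← real_inner_self_eq_norm_sq,
    hb.inner_sum]
  simp [Finset.sum_neg_distrib, Finset.sum_div, neg_div, sq]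

/-- Rotation invariance of Gaussian matrices: expanding the columns of a matrix with i.i.d.
standard Gaussian entries in an orthonormal basis gives independent standard Gaussian rows. -/
lemma gaussian_map_orthonormalBasis_rows {ι κ S : Type*} [Fintype ι] [Fintype κ] [Fintype S]
    (v : OrthonormalBasis S ℝ (EuclideanSpace ℝ ι)) :
    (Measure.pi fun _ : ι × κ => gaussianReal 0 1).map
        (fun ω s => (WithLp.toLp 2 fun l => ∑ i, v s i * ω (i, l) : EuclideanSpace ℝ κ)) =
      Measure.pi fun _ : S => stdGaussian (EuclideanSpace ℝ κ) := by
  classical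
  let T : (ι × κ → ℝ) →L[ℝ] (S → EuclideanSpace ℝ κ) :=
    ContinuousLinearMap.pi fun s =>
      (PiLp.continuousLinearEquiv 2 ℝ fun _ : κ => ℝ).symm.toContinuousLinearMap.comp
        (ContinuousLinearMap.pi fun l => ∑ i, v s i • ContinuousLinearMap.proj (i, l))
  have hT : (fun (ω : ι × κ → ℝ) s =>
      (WithLp.toLp 2 fun l => ∑ i, v s i * ω (i, l) : EuclideanSpace ℝ κ)) = ⇑T := by
    ext ω s l
    simp [T]
  rw [hT]
  apply Measure.ext_of_charFunDual
  ext L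
  rw [charFunDual_map, charFunDual_pi, charFunDual_pi]
  simp_rw [charFunDual_gaussianReal_zero_one, charFunDual_stdGaussian, ← Complex.exp_sum]
  congr 1
  let a : S → κ → ℝ := fun s l => L (Pi.single s (EuclideanSpace.single l 1))
  have h1 : ∀ i l, L (T (Pi.single (i, l) 1)) = ∑ s, v s i * a s l := by
    intro i l
    have : T (Pi.single (i, l) 1) = ∑ s, v s i •
        (Pi.single s (EuclideanSpace.single l (1 : ℝ)) : S → EuclideanSpace ℝ κ) := by
      ext s l'
      rw [← hT]
      simp [Finset.sum_apply, Pi.single_apply, ite_and, Prod.ext_iff, apply_ite]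
      by_cases h : l' = l <;> simp [h]
    simp [this, a]
  have h2 : ∀ s, ‖L.comp (.single ℝ (fun _ : S => EuclideanSpace ℝ κ) s)‖ ^ 2 =
      ∑ l, a s l ^ 2 := by
    intro s
    rw [(EuclideanSpace.basisFun κ ℝ).norm_dual]
    simp [a]
  have h3 : ∀ l, ∑ i, (∑ s, v s i * a s l) ^ 2 = ∑ s, a s l ^ 2 := by
    intro l
    have e1 : ‖∑ s, a s l • v s‖ ^ 2 = ∑ s, a s l ^ 2 := by
      rw [← real_inner_self_eq_norm_sq, v.orthonormal.inner_sum]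
      simp [sq]
    rw [← e1, EuclideanSpace.real_norm_sq_eq]
    simp [mul_comm]
  have h4 : ∑ i : ι × κ, (L (T (Pi.single i 1))) ^ 2 = ∑ s,
      ‖L.comp (.single ℝ (fun _ : S => EuclideanSpace ℝ κ) s)‖ ^ 2 := by
    simp_rw [h2, Fintype.sum_prod_type_right, h1, h3]
    exact Finset.sum_comm
  have h5 := congrArg (fun x : ℝ => -(x : ℂ) / 2) h4
  simpa [Finset.sum_neg_distrib, Finset.sum_div, neg_div] using h5

lemma lintegral_exp_mul_sq_gaussianReal {c : ℝ} (hc : c < 1 / 2) :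
    ∫⁻ x, ENNReal.ofReal (Real.exp (c * x ^ 2)) ∂gaussianReal 0 1 =
      ENNReal.ofReal (√(1 - 2 * c))⁻¹ := by
  rw [gaussianReal_of_var_ne_zero _ one_ne_zero, lintegral_withDensity_eq_lintegral_mul₀
    (by fun_prop) (by fun_prop)]
  have h : ∀ x : ℝ, (gaussianPDF 0 1 * fun x => ENNReal.ofReal (Real.exp (c * x ^ 2))) x =
      ENNReal.ofReal ((√(2 * Real.pi))⁻¹ * Real.exp (-(1 / 2 - c) * x ^ 2)) := by
    intro x
    rw [Pi.mul_apply, gaussianPDF, ← ENNReal.ofReal_mul (gaussianPDFReal_nonneg _ _ _),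
      gaussianPDFReal]
    simp only [NNReal.coe_one, mul_one, sub_zero]
    rw [mul_assoc, ← Real.exp_add]
    congr 3
    ring
  simp_rw [h]
  rw [← ofReal_integral_eq_lintegral_ofReal
    ((integrable_exp_neg_mul_sq (by linarith)).const_mul _)
    (Filter.Eventually.of_forall fun x => by positivity), integral_const_mul, integral_gaussian]
  congr 1
  rw [← Real.sqrt_inv, ← Real.sqrt_inv, ← Real.sqrt_mul (by positivity)]
  congr 1
  have := Real.pi_pos
  have h2 : (1 : ℝ) - 2 * c ≠ 0 := by linarith
  have h3 : (1 / 2 : ℝ) - c ≠ 0 := by linarith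
  field_simp

lemma lintegral_exp_mul_sum_sq_stdGaussian {κ : Type*} [Fintype κ] {b : κ → E}
    (hb : Orthonormal ℝ b) {c : ℝ} (hc : c < 1 / 2) :
    ∫⁻ x, ENNReal.ofReal (Real.exp (c * ∑ i, inner ℝ (b i) x ^ 2)) ∂stdGaussian E =
      ENNReal.ofReal (√(1 - 2 * c))⁻¹ ^ Fintype.card κ := by
  have h1 : ∫⁻ x, ENNReal.ofReal (Real.exp (c * ∑ i, inner ℝ (b i) x ^ 2)) ∂stdGaussian E =
      ∫⁻ y, ENNReal.ofReal (Real.exp (c * ∑ i, y i ^ 2))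
        ∂(Measure.pi fun _ : κ => gaussianReal 0 1) := by
    rw [← stdGaussian_map_inner_orthonormal hb, lintegral_map (by fun_prop) (by fun_prop)]
  rw [h1]
  simp_rw [Finset.mul_sum, Real.exp_sum]
  simp_rw [ENNReal.ofReal_prod_of_nonneg (fun _ _ => (Real.exp_pos _).le)]
  rw [lintegral_prod_eq_prod_lintegral_of_indepFun Finset.univ
    (fun i (y : κ → ℝ) => ENNReal.ofReal (Real.exp (c * y i ^ 2)))
    (iIndepFun_pi (X := fun _ x => ENNReal.ofReal (Real.exp (c * x ^ 2)))
      fun _ => by fun_prop) (fun i => by fun_prop)]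
  have h2 : ∀ i : κ, ∫⁻ y : κ → ℝ, ENNReal.ofReal (Real.exp (c * y i ^ 2))
      ∂(Measure.pi fun _ : κ => gaussianReal 0 1) = ENNReal.ofReal (√(1 - 2 * c))⁻¹ := by
    intro i
    rw [← lintegral_exp_mul_sq_gaussianReal hc,
      (measurePreserving_eval (fun _ : κ => gaussianReal 0 1) i).lintegral_comp
        (f := fun x => ENNReal.ofReal (Real.exp (c * x ^ 2))) (by fun_prop)]
  simp [h2]

lemma stdGaussian_submodule_eq_zero {S : Submodule ℝ E} (hS : S ≠ ⊤) :
    stdGaussian E (S : Set E) = 0 := by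
  obtain ⟨u, hu, hu0⟩ := Submodule.exists_mem_ne_zero_of_ne_bot
    (mt Submodule.orthogonal_eq_bot_iff.mp hS)
  have hb : Orthonormal ℝ fun _ : Unit => (‖u‖⁻¹ • u) := by
    refine ⟨fun _ => by simp [norm_smul, hu0], fun i j hij => (hij rfl).elim⟩
  refine measure_mono_null (t := (fun x (_ : Unit) => inner ℝ (‖u‖⁻¹ • u) x) ⁻¹' {0}) ?_ ?_
  · intro x hx
    ext
    simp [inner_smul_left, Submodule.inner_left_of_mem_orthogonal hx hu]
  · rw [← Measure.map_apply (by fun_prop) (measurableSet_singleton _),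
      stdGaussian_map_inner_orthonormal hb]
    have : ({0} : Set (Unit → ℝ)) = Set.univ.pi fun _ => {0} := by
      ext; simp [funext_iff]
    have := nullSingletonClass_gaussianReal (μ := 0) (v := 1) one_ne_zero
    simp [*]

end GaussianLaws

section InverseMoment

/-- Laplace-transform lower bound for `x ↦ x⁻²`, arranged to make sense for `a = 0`. -/
lemma ofReal_sq_le_lintegral_mul_exp {a t : ℝ} (ht : 0 ≤ t) (hat : a * t ≤ 1) :
    ENNReal.ofReal (t ^ 2) ≤
      ∫⁻ s in Set.Ioi (0 : ℝ), ENNReal.ofReal (s * Real.exp (-s * a)) := by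
  rcases ht.eq_or_lt with rfl | ht
  · simp
  have hint : ∫ s in Set.Ioi (0 : ℝ), s * Real.exp (-s * t⁻¹) = t ^ 2 := by
    have := Real.integral_rpow_mul_exp_neg_mul_Ioi (a := 2) two_pos (inv_pos.mpr ht)
    norm_num at this
    rw [← this]
    exact integral_congr_ae (Filter.Eventually.of_forall fun s => by ring_nf)
  have hI : IntegrableOn (fun s : ℝ => s * Real.exp (-s * t⁻¹)) (Set.Ioi 0) := by
    by_contra h
    have h0 := integral_undef h
    rw [hint] at h0
    exact (pow_pos ht 2).ne' h0
  rw [← hint, ofReal_integral_eq_lintegral_ofReal hI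
    ((ae_restrict_iff' measurableSet_Ioi).mpr (Filter.Eventually.of_forall fun s hs =>
      mul_nonneg (le_of_lt hs) (Real.exp_pos _).le))]
  refine setLIntegral_mono_ae (by fun_prop) (Filter.Eventually.of_forall fun s hs => ?_)
  have hs : 0 < s := hs
  have : a ≤ t⁻¹ := by rwa [← one_div, le_div_iff₀ ht]
  apply ENNReal.ofReal_le_ofReal
  exact mul_le_mul_of_nonneg_left (Real.exp_le_exp.mpr (by nlinarith)) hs.le

lemma lintegral_mul_inv_one_add_pow_three :
    ∫⁻ s in Set.Ioi (0 : ℝ), ENNReal.ofReal (s * ((1 + 2 * s) ^ 3)⁻¹) = ENNReal.ofReal (1 / 8) := by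
  have hd : ∀ s ∈ Set.Ioi (0 : ℝ),
      HasDerivAt (fun s : ℝ => s ^ 2 / (2 * (1 + 2 * s) ^ 2)) (s * ((1 + 2 * s) ^ 3)⁻¹) s := by
    intro s hs
    have hs : 0 < s := hs
    have h1 : HasDerivAt (fun s : ℝ => 2 * (1 + 2 * s) ^ 2) (2 * (2 * (1 + 2 * s) * 2)) s := by
      have := ((((hasDerivAt_id s).const_mul 2).const_add 1).pow 2).const_mul 2
      simpa using this
    have h2 := (hasDerivAt_pow 2 s).div h1 (by positivity)
    refine h2.congr_deriv ?_
    have : 1 + 2 * s ≠ 0 := by positivity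
    field_simp
    push_cast
    ring
  have hc : ContinuousWithinAt (fun s : ℝ => s ^ 2 / (2 * (1 + 2 * s) ^ 2)) (Set.Ici 0) 0 :=
    (ContinuousAt.div (by fun_prop) (by fun_prop) (by norm_num)).continuousWithinAt
  have hn : ∀ s ∈ Set.Ioi (0 : ℝ), 0 ≤ s * ((1 + 2 * s) ^ 3)⁻¹ := by
    intro s hs
    have hs : 0 < s := hs
    positivity
  have hl : Filter.Tendsto (fun s : ℝ => s ^ 2 / (2 * (1 + 2 * s) ^ 2)) Filter.atTop
      (nhds (1 / 8)) := by
    have h0 : Filter.Tendsto (fun s : ℝ => 1 / (2 * (s⁻¹ + 2) ^ 2)) Filter.atTop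
        (nhds (1 / (2 * (0 + 2) ^ 2))) :=
      tendsto_const_nhds.div
        (((tendsto_inv_atTop_zero.add_const 2).pow 2).const_mul 2) (by norm_num)
    norm_num at h0 ⊢
    refine h0.congr' ?_
    filter_upwards [Filter.eventually_gt_atTop 0] with s hs
    field_simp
  rw [← ofReal_integral_eq_lintegral_ofReal (integrableOn_Ioi_deriv_of_nonneg hc hd hn hl)
    ((ae_restrict_iff' measurableSet_Ioi).mpr (Filter.Eventually.of_forall hn)),
    integral_Ioi_of_hasDerivAt_of_nonneg hc hd hn hl]
  norm_num

variable {E : Type*} [NormedAddCommGroup E] [InnerProductSpace ℝ E] [FiniteDimensional ℝ E]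
  [MeasurableSpace E] [BorelSpace E]

/-- The expectation of `χ₆⁻⁴` is `1 / 8`; here as an upper bound for any function dominated by
`χ₆⁻²`. -/
lemma lintegral_sq_le_of_mul_sum_sq_le_one {b : Fin 6 → E} (hb : Orthonormal ℝ b)
    {f : E → ℝ} (hf : ∀ x, 0 ≤ f x) (hbf : ∀ x, (∑ i, inner ℝ (b i) x ^ 2) * f x ≤ 1) :
    ∫⁻ x, ENNReal.ofReal (f x ^ 2) ∂stdGaussian E ≤ ENNReal.ofReal (1 / 8) := by
  calc ∫⁻ x, ENNReal.ofReal (f x ^ 2) ∂stdGaussian E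
      ≤ ∫⁻ x, (∫⁻ s in Set.Ioi (0 : ℝ),
          ENNReal.ofReal (s * Real.exp (-s * ∑ i, inner ℝ (b i) x ^ 2))) ∂stdGaussian E :=
        lintegral_mono fun x => ofReal_sq_le_lintegral_mul_exp (hf x) (hbf x)
    _ = ∫⁻ s in Set.Ioi (0 : ℝ), ∫⁻ x,
          ENNReal.ofReal (s * Real.exp (-s * ∑ i, inner ℝ (b i) x ^ 2)) ∂stdGaussian E :=
        lintegral_lintegral_swap (by fun_prop)
    _ = ∫⁻ s in Set.Ioi (0 : ℝ), ENNReal.ofReal (s * ((1 + 2 * s) ^ 3)⁻¹) := by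
        refine setLIntegral_congr_fun measurableSet_Ioi fun s hs => ?_
        have hs : 0 < s := hs
        simp_rw [ENNReal.ofReal_mul hs.le]
        rw [lintegral_const_mul _ (by fun_prop),
          lintegral_exp_mul_sum_sq_stdGaussian hb (by linarith), ← ENNReal.ofReal_pow (by positivity)]
        congr 2
        rw [Fintype.card_fin, show 6 = 2 * 3 from rfl, pow_mul, inv_pow,
          Real.sq_sqrt (by linarith), inv_pow]
        ring_nf
    _ = _ := lintegral_mul_inv_one_add_pow_three

end InverseMoment

section ProductMeasures

lemma lintegral_pi_le_of_update {ι : Type*} [Fintype ι] [DecidableEq ι] {X : Type*}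
    [MeasurableSpace X] {μ : Measure X} [IsProbabilityMeasure μ] {f : (ι → X) → ENNReal}
    (hf : Measurable f) {C : ENNReal} (i : ι)
    (h : ∀ y : ι → X, ∫⁻ x, f (Function.update y i x) ∂μ ≤ C) :
    ∫⁻ y, f y ∂(Measure.pi fun _ => μ) ≤ C := by
  rcases isEmpty_or_nonempty X with hX | ⟨⟨x₀⟩⟩
  · have : IsEmpty (ι → X) := ⟨fun y => hX.elim (y i)⟩
    simp [lintegral_of_isEmpty]
  rw [lintegral_eq_lmarginal_univ (fun _ => x₀), lmarginal_erase' _ hf (Finset.mem_univ i)]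
  calc _ ≤ (∫⋯∫⁻_Finset.univ.erase i, (fun _ => C) ∂fun _ : ι => μ) (fun _ => x₀) :=
        lmarginal_mono h _
    _ = C := by simp [lmarginal]

variable {E : Type*} [NormedAddCommGroup E] [InnerProductSpace ℝ E] [FiniteDimensional ℝ E]
  [MeasurableSpace E] [BorelSpace E]

/-- At most `dim E` independent Gaussian vectors are almost surely linearly independent. -/
lemma ae_linearIndependent_pi_stdGaussian {r : ℕ} (hr : r ≤ Module.finrank ℝ E) :
    ∀ᵐ y ∂(Measure.pi fun _ : Fin r => stdGaussian E), LinearIndependent ℝ y := by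
  induction r with
  | zero => exact Filter.Eventually.of_forall fun y => linearIndependent_empty_type
  | succ r ih =>
    have hmp := measurePreserving_piFinSuccAbove (fun _ : Fin (r + 1) => stdGaussian E) 0
    have hmeas : MeasurableSet {p : E × (Fin r → E) | LinearIndependent ℝ
        (Fin.cons p.1 p.2 : Fin (r + 1) → E)} := by
      refine (isOpen_setOfPred_linearIndependent.preimage ?_).measurableSet
      fun_prop
    have key : ∀ᵐ p ∂((stdGaussian E).prod (Measure.pi fun _ : Fin r => stdGaussian E)),
        LinearIndependent ℝ (Fin.cons p.1 p.2 : Fin (r + 1) → E) := by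
      rw [Measure.ae_prod_iff_ae_ae hmeas, Measure.ae_ae_comm hmeas]
      filter_upwards [ih (by omega)] with y hy
      have hS : Submodule.span ℝ (Set.range y) ≠ ⊤ := by
        intro h
        have := finrank_span_eq_card hy
        rw [h, finrank_top, Fintype.card_fin] at this
        omega
      filter_upwards [measure_eq_zero_iff_ae_notMem.mp (stdGaussian_submodule_eq_zero hS)]
        with x hx
      exact linearIndependent_finCons.mpr ⟨hy, hx⟩
    filter_upwards [hmp.quasiMeasurePreserving.ae key] with y hy
    convert hy
    ext i
    refine Fin.cases ?_ (fun j => ?_) i <;> simp [MeasurableEquiv.piFinSuccAbove, Fin.tail]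

end ProductMeasures

section GramDual

variable {E : Type*} [NormedAddCommGroup E] [InnerProductSpace ℝ E]

/-- The columns of the Moore–Penrose pseudo-inverse of the matrix with rows `y`: the family dual
to `y` inside the span of `y`, when `y` is linearly independent. -/
noncomputable def gramDual {ι : Type*} [Fintype ι] [DecidableEq ι] (y : ι → E) (i : ι) : E :=
  ∑ l, (gram ℝ y)⁻¹ l i • y l

variable {ι : Type*} [Fintype ι] [DecidableEq ι]

lemma inner_gramDual {y : ι → E} (hy : (gram ℝ y).det ≠ 0) (i j : ι) :
    inner ℝ (y j) (gramDual y i) = if j = i then 1 else 0 := by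
  have h := congrFun (congrFun (mul_nonsing_inv (gram ℝ y) (isUnit_iff_ne_zero.mpr hy)) j) i
  rw [mul_apply, one_apply] at h
  rw [← h, gramDual, inner_sum]
  simp [inner_smul_right, gram_apply, mul_comm]

lemma measurable_gramDual [MeasurableSpace E] [BorelSpace E] [SecondCountableTopology E] (i : ι) :
    Measurable fun y : ι → E => gramDual y i := by
  have hg : Continuous fun y : ι → E => gram ℝ y := by
    refine continuous_matrix fun a b => ?_
    simp only [gram_apply]
    fun_prop
  have h : ∀ l, Measurable fun y : ι → E => (gram ℝ y)⁻¹ l i := by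
    intro l
    simp_rw [inv_def, Ring.inverse_eq_inv', Matrix.smul_apply, smul_eq_mul]
    exact hg.matrix_det.measurable.inv.mul (hg.matrix_adjugate.matrix_elem l i).measurable
  unfold gramDual
  exact Finset.measurable_sum _ fun l _ => (h l).smul (measurable_pi_apply l)

/-- The dual vector `gramDual y i` is no longer than the inverse of the length of any component of
`y i` orthogonal to the other vectors of the family. -/
lemma sum_inner_sq_mul_norm_gramDual_sq_le_one {κ : Type*} [Fintype κ] {b : κ → E}
    (hb : Orthonormal ℝ b) (y : ι → E) (i : ι) (hby : ∀ k, ∀ j ≠ i, inner ℝ (b k) (y j) = 0) :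
    (∑ k, inner ℝ (b k) (y i) ^ 2) * ‖gramDual y i‖ ^ 2 ≤ 1 := by
  by_cases hdet : (gram ℝ y).det = 0
  · have : gramDual y i = 0 := by
      simp [gramDual, inv_def, hdet]
    simp [this]
  set g := gramDual y i with hg
  set p := ∑ k, inner ℝ (b k) (y i) • b k with hp
  have hpy : ∀ x, inner ℝ p x = ∑ k, inner ℝ (b k) (y i) * inner ℝ (b k) x := by
    intro x
    simp [hp, sum_inner, inner_smul_left]
  have hpp : ‖p‖ ^ 2 = ∑ k, inner ℝ (b k) (y i) ^ 2 := by
    rw [← real_inner_self_eq_norm_sq, hp, hb.inner_sum]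
    simp [sq]
  have hgg : ‖g‖ ^ 2 = (gram ℝ y)⁻¹ i i := by
    rw [← real_inner_self_eq_norm_sq]
    nth_rw 1 [hg, gramDual]
    simp [sum_inner, inner_smul_left, hg, inner_gramDual hdet]
  have hpg : inner ℝ p g = ‖g‖ ^ 2 * ‖p‖ ^ 2 := by
    rw [hgg, hpp, hg, gramDual, inner_sum, Finset.sum_eq_single i]
    · rw [inner_smul_right, hpy]
      simp [sq]
    · intro j _ hj
      rw [inner_smul_right, hpy]
      simp [hby _ j hj]
    · simp
  have hcs := real_inner_le_norm p g
  rw [hpg] at hcs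
  rw [← hpp, ← mul_pow]
  have h0 : 0 ≤ ‖p‖ * ‖g‖ := by positivity
  have : ‖p‖ * ‖g‖ ≤ 1 := by
    by_contra! h
    nlinarith
  exact pow_le_one₀ h0 this

variable [FiniteDimensional ℝ E] [MeasurableSpace E] [BorelSpace E]

lemma lintegral_norm_gramDual_pow_four_le {r : ℕ} (hr : r + 5 ≤ Module.finrank ℝ E) (i : Fin r) :
    ∫⁻ y, ENNReal.ofReal ((‖gramDual y i‖ ^ 2) ^ 2) ∂(Measure.pi fun _ : Fin r => stdGaussian E) ≤
      ENNReal.ofReal (1 / 8) := by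
  have hm := measurable_gramDual (E := E) i
  refine lintegral_pi_le_of_update (by fun_prop) i fun y => ?_
  let s : Finset (Fin r) := Finset.univ.erase i
  let V : Submodule ℝ E := Submodule.span ℝ (Set.range fun j : s => y j)
  have hV : Module.finrank ℝ V ≤ r - 1 := by
    refine (finrank_range_le_card _).trans ?_
    simp [s]
  have hVo : 6 ≤ Module.finrank ℝ Vᗮ := by
    have := V.finrank_add_finrank_orthogonal
    have := i.pos
    omega
  let b : Fin 6 → E := fun k => (stdOrthonormalBasis ℝ Vᗮ (Fin.castLE hVo k) : Vᗮ)
  have hb : Orthonormal ℝ b :=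
    ((stdOrthonormalBasis ℝ Vᗮ).orthonormal.comp_linearIsometry Vᗮ.subtypeₗᵢ).comp _
      (Fin.castLE_injective hVo)
  refine lintegral_sq_le_of_mul_sum_sq_le_one hb (fun x => by positivity) fun x => ?_
  have := sum_inner_sq_mul_norm_gramDual_sq_le_one hb (Function.update y i x) i ?_
  · simpa using this
  · intro k j hj
    rw [Function.update_of_ne hj]
    refine Submodule.inner_left_of_mem_orthogonal (K := V) ?_ (Subtype.coe_prop _)
    exact Submodule.subset_span ⟨⟨j, by simp [s, hj]⟩, rfl⟩

lemma pi_stdGaussian_sum_norm_gramDual_sq_gt_le {r : ℕ} (hr : 1 ≤ r)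
    (hrE : r + 5 ≤ Module.finrank ℝ E) :
    (Measure.pi fun _ : Fin r => stdGaussian E) {y | 10 * (r : ℝ) < ∑ i, ‖gramDual y i‖ ^ 2} ≤
      ENNReal.ofReal (1 / 800) := by
  have hm := fun i : Fin r => measurable_gramDual (E := E) i
  have hr0 : (0 : ℝ) < r := by exact_mod_cast hr
  have hint : ∫⁻ y, ENNReal.ofReal ((∑ i, ‖gramDual y i‖ ^ 2) ^ 2)
      ∂(Measure.pi fun _ : Fin r => stdGaussian E) ≤ ENNReal.ofReal (r ^ 2 / 8) := by
    calc _ ≤ ∫⁻ y, ENNReal.ofReal r * ∑ i, ENNReal.ofReal ((‖gramDual y i‖ ^ 2) ^ 2)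
          ∂(Measure.pi fun _ : Fin r => stdGaussian E) := by
          refine lintegral_mono fun y => ?_
          rw [← ENNReal.ofReal_sum_of_nonneg (fun _ _ => by positivity),
            ← ENNReal.ofReal_mul hr0.le]
          apply ENNReal.ofReal_le_ofReal
          simpa using sq_sum_le_card_mul_sum_sq (s := (Finset.univ : Finset (Fin r)))
            (f := fun i => ‖gramDual y i‖ ^ 2)
      _ ≤ ENNReal.ofReal r * ∑ _i : Fin r, ENNReal.ofReal (1 / 8) := by
          rw [lintegral_const_mul _ (by fun_prop), lintegral_finsetSum _ (by fun_prop)]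
          gcongr with i
          exact lintegral_norm_gramDual_pow_four_le hrE i
      _ = _ := by
          rw [← ENNReal.ofReal_sum_of_nonneg (fun _ _ => by positivity),
            ← ENNReal.ofReal_mul hr0.le]
          congr 1
          rw [Finset.sum_const, Finset.card_univ, Fintype.card_fin, nsmul_eq_mul]
          ring
  have hmk := (mul_meas_ge_le_lintegral (μ := Measure.pi fun _ : Fin r => stdGaussian E)
    (f := fun y => ENNReal.ofReal ((∑ i, ‖gramDual y i‖ ^ 2) ^ 2)) (by fun_prop)
    (ENNReal.ofReal ((10 * r) ^ 2))).trans hint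
  have hpos : ENNReal.ofReal ((10 * (r : ℝ)) ^ 2) ≠ 0 := by
    simpa using by positivity
  calc _ ≤ (Measure.pi fun _ : Fin r => stdGaussian E) {y | ENNReal.ofReal ((10 * r) ^ 2) ≤
          ENNReal.ofReal ((∑ i, ‖gramDual y i‖ ^ 2) ^ 2)} := by
        refine measure_mono fun y hy => ?_
        have hy : 10 * (r : ℝ) < ∑ i, ‖gramDual y i‖ ^ 2 := hy
        exact ENNReal.ofReal_le_ofReal (by gcongr)
    _ ≤ ENNReal.ofReal (r ^ 2 / 8) / ENNReal.ofReal ((10 * r) ^ 2) := by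
        rw [ENNReal.le_div_iff_mul_le (.inl hpos) (.inl ENNReal.ofReal_ne_top), mul_comm]
        exact hmk
    _ = _ := by
        rw [← ENNReal.ofReal_div_of_pos (by positivity)]
        congr 1
        field_simp
        norm_num

end GramDual

section ChiSquareTail

variable {E : Type*} [NormedAddCommGroup E] [InnerProductSpace ℝ E] [FiniteDimensional ℝ E]
  [MeasurableSpace E] [BorelSpace E]

lemma pi_stdGaussian_sum_inner_sq_gt_le {κ : Type*} [Fintype κ] {J : Finset κ} {M : ℕ}
    (hJ : J.card ≤ M) (g : E) :
    (Measure.pi fun _ : κ => stdGaussian E)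
        {z | 12 * (M : ℝ) * ‖g‖ ^ 2 < ∑ j ∈ J, inner ℝ (z j) g ^ 2} ≤
      ENNReal.ofReal ((1 / 10) ^ M) := by
  rcases eq_or_ne g 0 with rfl | hg
  · simp
  have hg' : 0 < ‖g‖ := norm_pos_iff.mpr hg
  set u : E := ‖g‖⁻¹ • g with hu
  have hb : Orthonormal ℝ fun _ : Unit => u :=
    ⟨fun _ => by simp [hu, norm_smul, hg], fun i j hij => (hij rfl).elim⟩
  have hgu : ∀ x : E, inner ℝ x g ^ 2 = ‖g‖ ^ 2 * inner ℝ u x ^ 2 := by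
    intro x
    rw [hu, inner_smul_left, real_inner_comm]
    simp
    field_simp
  have hint : ∫⁻ z, ∏ j ∈ J, ENNReal.ofReal (Real.exp (1 / 4 * inner ℝ u (z j) ^ 2))
      ∂(Measure.pi fun _ : κ => stdGaussian E) = ENNReal.ofReal √2 ^ J.card := by
    rw [lintegral_prod_eq_prod_lintegral_of_indepFun J
      (fun j (z : κ → E) => ENNReal.ofReal (Real.exp (1 / 4 * inner ℝ u (z j) ^ 2)))
      (iIndepFun_pi (X := fun _ x => ENNReal.ofReal (Real.exp (1 / 4 * inner ℝ u x ^ 2)))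
        fun _ => by fun_prop) (fun i => by fun_prop)]
    refine Finset.prod_eq_pow_card fun j _ => ?_
    rw [(measurePreserving_eval (fun _ : κ => stdGaussian E) j).lintegral_comp
      (f := fun x => ENNReal.ofReal (Real.exp (1 / 4 * inner ℝ u x ^ 2))) (by fun_prop)]
    have := lintegral_exp_mul_sum_sq_stdGaussian hb (c := 1 / 4) (by norm_num)
    simp only [Finset.univ_unique, Finset.sum_singleton, Fintype.card_unique, pow_one] at this
    rw [this, ← Real.sqrt_inv]
    norm_num
  have hmk := (mul_meas_ge_le_lintegral (μ := Measure.pi fun _ : κ => stdGaussian E)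
    (f := fun z => ∏ j ∈ J, ENNReal.ofReal (Real.exp (1 / 4 * inner ℝ u (z j) ^ 2)))
    (by fun_prop) (ENNReal.ofReal (Real.exp (3 * M)))).trans hint.le
  have hpos : ENNReal.ofReal (Real.exp (3 * M)) ≠ 0 := by
    simpa using Real.exp_pos _
  calc _ ≤ (Measure.pi fun _ : κ => stdGaussian E) {z | ENNReal.ofReal (Real.exp (3 * M)) ≤
          ∏ j ∈ J, ENNReal.ofReal (Real.exp (1 / 4 * inner ℝ u (z j) ^ 2))} := by
        refine measure_mono fun z hz => ?_
        have hz : 12 * (M : ℝ) * ‖g‖ ^ 2 < ∑ j ∈ J, inner ℝ (z j) g ^ 2 := hz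
        simp_rw [hgu, ← Finset.mul_sum] at hz
        rw [mul_comm, mul_lt_mul_iff_right₀ (by positivity)] at hz
        rw [Set.mem_ofPred_eq, ← ENNReal.ofReal_prod_of_nonneg (fun _ _ => (Real.exp_pos _).le),
          ← Real.exp_sum, ← Finset.mul_sum]
        exact ENNReal.ofReal_le_ofReal (Real.exp_le_exp.mpr (by linarith))
    _ ≤ ENNReal.ofReal √2 ^ J.card / ENNReal.ofReal (Real.exp (3 * M)) := by
        rw [ENNReal.le_div_iff_mul_le (.inl hpos) (.inl ENNReal.ofReal_ne_top), mul_comm]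
        exact hmk
    _ ≤ ENNReal.ofReal ((1 / 10) ^ M) := by
        rw [← ENNReal.ofReal_pow (by positivity), ← ENNReal.ofReal_div_of_pos (Real.exp_pos _)]
        apply ENNReal.ofReal_le_ofReal
        have h2 : (1 : ℝ) ≤ √2 := Real.one_le_sqrt.mpr one_le_two
        have h3 : √2 ≤ 3 / 2 := by
          rw [Real.sqrt_le_left (by norm_num)]
          norm_num
        have h4 : (15 : ℝ) ≤ Real.exp 3 := by
          have h1 := Real.exp_one_gt_d9
          have : Real.exp 3 = Real.exp 1 ^ 3 := by rw [← Real.exp_nat_mul]; norm_num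
          rw [this]
          calc (15 : ℝ) ≤ 2.7 ^ 3 := by norm_num
            _ ≤ Real.exp 1 ^ 3 := by gcongr; linarith
        calc √2 ^ J.card / Real.exp (3 * M) ≤ √2 ^ M / Real.exp (3 * M) := by gcongr
          _ = (√2 / Real.exp 3) ^ M := by
            rw [div_pow, ← Real.exp_nat_mul, mul_comm (3 : ℝ)]
          _ ≤ _ := by
            refine pow_le_pow_left₀ (by positivity) ?_ M
            rw [div_le_iff₀ (Real.exp_pos _)]
            linarith

end ChiSquareTail

section GoodEvent

variable {E : Type*} [NormedAddCommGroup E] [InnerProductSpace ℝ E] [FiniteDimensional ℝ E]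
  [MeasurableSpace E] [BorelSpace E]

lemma prod_pi_stdGaussian_exceptional_le {r : ℕ} {κ : Type*} [Fintype κ] {J : Finset κ} {M : ℕ}
    (hr : 1 ≤ r) (hrE : r + 5 ≤ Module.finrank ℝ E) (hrM : r + 5 ≤ M) (hJ : J.card ≤ M) :
    ((Measure.pi fun _ : Fin r => stdGaussian E).prod (Measure.pi fun _ : κ => stdGaussian E))
        {p | (gram ℝ p.1).det ≠ 0 ∧
          ∑ i, ∑ j ∈ J, inner ℝ (p.2 j) (gramDual p.1 i) ^ 2 ≤ 120 * (M : ℝ) * r}ᶜ ≤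
      ENNReal.ofReal 0.002 := by
  have hm := fun i : Fin r => measurable_gramDual (E := E) i
  set μ := Measure.pi fun _ : Fin r => stdGaussian E
  set ν := Measure.pi fun _ : κ => stdGaussian E
  let N : Set (Fin r → E) := {y | ¬ LinearIndependent ℝ y}
  let B : Set (Fin r → E) := {y | 10 * (r : ℝ) < ∑ i, ‖gramDual y i‖ ^ 2}
  let T : Fin r → Set ((Fin r → E) × (κ → E)) := fun i =>
    {p | 12 * (M : ℝ) * ‖gramDual p.1 i‖ ^ 2 < ∑ j ∈ J, inner ℝ (p.2 j) (gramDual p.1 i) ^ 2}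
  have hN : (μ.prod ν) (N ×ˢ Set.univ) = 0 := by
    have h : μ N = 0 := ae_linearIndependent_pi_stdGaussian (by omega)
    rw [Measure.prod_prod, h, zero_mul]
  have hB : (μ.prod ν) (B ×ˢ Set.univ) ≤ ENNReal.ofReal (1 / 800) := by
    rw [Measure.prod_prod, measure_univ, mul_one]
    exact pi_stdGaussian_sum_norm_gramDual_sq_gt_le hr hrE
  have hT : ∀ i, (μ.prod ν) (T i) ≤ ENNReal.ofReal ((1 / 10) ^ M) := by
    intro i
    have hTm : MeasurableSet (T i) := by
      have := hm i
      exact measurableSet_lt (by fun_prop) (by fun_prop)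
    rw [Measure.prod_apply hTm]
    calc _ ≤ ∫⁻ _, ENNReal.ofReal ((1 / 10) ^ M) ∂μ :=
          lintegral_mono fun y => pi_stdGaussian_sum_inner_sq_gt_le hJ (gramDual y i)
      _ = _ := by rw [lintegral_const, measure_univ, mul_one]
  have hsub : {p : (Fin r → E) × (κ → E) | (gram ℝ p.1).det ≠ 0 ∧
      ∑ i, ∑ j ∈ J, inner ℝ (p.2 j) (gramDual p.1 i) ^ 2 ≤ 120 * (M : ℝ) * r}ᶜ ⊆
        N ×ˢ Set.univ ∪ (B ×ˢ Set.univ ∪ ⋃ i, T i) := by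
    intro p hp
    by_contra! h
    simp only [Set.mem_union, Set.mem_prod, Set.mem_univ, and_true, Set.mem_iUnion, not_or,
      not_exists] at h
    obtain ⟨hpN, hpB, hpT⟩ := h
    have hpN : LinearIndependent ℝ p.1 := not_not.mp hpN
    have hpB : ∑ i, ‖gramDual p.1 i‖ ^ 2 ≤ 10 * (r : ℝ) := not_lt.mp hpB
    have hpT : ∀ i, ∑ j ∈ J, inner ℝ (p.2 j) (gramDual p.1 i) ^ 2 ≤
      12 * (M : ℝ) * ‖gramDual p.1 i‖ ^ 2 := fun i => not_lt.mp (hpT i)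
    refine hp ⟨det_gram_ne_zero_iff_linearIndependent.mpr hpN, ?_⟩
    calc _ ≤ ∑ i, 12 * (M : ℝ) * ‖gramDual p.1 i‖ ^ 2 := Finset.sum_le_sum fun i _ => hpT i
      _ = 12 * (M : ℝ) * ∑ i, ‖gramDual p.1 i‖ ^ 2 := by rw [Finset.mul_sum]
      _ ≤ 12 * (M : ℝ) * (10 * r) := by gcongr
      _ = _ := by ring
  have hrT : r * (1 / 10 : ℝ) ^ M ≤ 1 / 100000 := by
    have h10 : (r : ℝ) ≤ 10 ^ r := by exact_mod_cast (Nat.lt_pow_self (by norm_num)).le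
    calc r * (1 / 10 : ℝ) ^ M ≤ 10 ^ r * (1 / 10 : ℝ) ^ (r + 5) := by
          gcongr ?_ * ?_
          exact pow_le_pow_of_le_one (by norm_num) (by norm_num) hrM
      _ = (10 * (1 / 10)) ^ r * (1 / 10 : ℝ) ^ 5 := by rw [mul_pow, pow_add, mul_assoc]
      _ ≤ _ := by norm_num
  calc _ ≤ (μ.prod ν) (N ×ˢ Set.univ) + ((μ.prod ν) (B ×ˢ Set.univ) + ∑ i, (μ.prod ν) (T i)) :=
        (measure_mono hsub).trans <| (measure_union_le _ _).trans <| by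
          gcongr
          exact (measure_union_le _ _).trans <| by
            gcongr
            exact measure_iUnion_fintype_le _ _
    _ ≤ 0 + (ENNReal.ofReal (1 / 800) + ∑ _i : Fin r, ENNReal.ofReal ((1 / 10) ^ M)) := by
        gcongr
        · exact hN.le
        · exact hT _
    _ ≤ _ := by
        rw [zero_add, ← ENNReal.ofReal_sum_of_nonneg (fun _ _ => by positivity),
          ← ENNReal.ofReal_add (by positivity) (by positivity)]
        apply ENNReal.ofReal_le_ofReal
        rw [Finset.sum_const, Finset.card_univ, Fintype.card_fin, nsmul_eq_mul]
        norm_num at hrT ⊢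
        linarith

end GoodEvent

section RangeFinder

variable {X Y E : Type*} [NormedAddCommGroup X] [InnerProductSpace ℝ X]
  [NormedAddCommGroup Y] [InnerProductSpace ℝ Y] [NormedAddCommGroup E] [InnerProductSpace ℝ E]

lemma norm_sub_apply_le_of_isSymmetric {Q : Y →ₗ[ℝ] Y} (hQ : Q.IsSymmetric)
    (hQQ : ∀ u, Q (Q u) = Q u) (u : Y) : ‖u - Q u‖ ≤ ‖u‖ := by
  have h : inner ℝ (u - Q u) (Q u) = 0 := by
    rw [inner_sub_left, hQ u (Q u), hQQ, sub_self]
  have hsq := norm_add_sq_eq_norm_sq_add_norm_sq_real h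
  rw [sub_add_cancel] at hsq
  nlinarith [norm_nonneg u, norm_nonneg (u - Q u), norm_nonneg (Q u)]

/-- Deterministic error bound for the randomized range finder `W` applied to `T`: `y` and `z` are
the components of `W` along the leading and trailing right singular vectors of `T`. -/
lemma norm_sub_projection_le {ι κ : Type*} [Fintype ι] [DecidableEq ι] [Fintype κ]
    (v : OrthonormalBasis (ι ⊕ κ) ℝ X) (T : X →ₗ[ℝ] Y) (W : E →ₗ[ℝ] X) (Q : Y →ₗ[ℝ] Y)
    (hQ : Q.IsSymmetric) (hQQ : ∀ u, Q (Q u) = Q u) (hQT : ∀ w, Q (T (W w)) = T (W w))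
    {y : ι → E} {z : κ → E} (hy : ∀ i w, inner ℝ (v (.inl i)) (W w) = inner ℝ (y i) w)
    (hz : ∀ j w, inner ℝ (v (.inr j)) (W w) = inner ℝ (z j) w) (hdet : (gram ℝ y).det ≠ 0)
    {J : Finset κ} {s C : ℝ} (hs : 0 ≤ s) (hC : 0 ≤ C)
    (hT : ∀ a : κ → ℝ, ‖T (∑ j, a j • v (.inr j))‖ ≤ s * √(∑ j ∈ J, a j ^ 2))
    (hyz : ∑ i, ∑ j ∈ J, inner ℝ (z j) (gramDual y i) ^ 2 ≤ C ^ 2) (x : X) :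
    ‖T x - Q (T x)‖ ≤ (1 + C) * s * ‖x‖ := by
  set w : E := ∑ i, inner ℝ (v (.inl i)) x • gramDual y i with hw
  have hx : x - W w = ∑ j, (inner ℝ (v (.inr j)) x - inner ℝ (z j) w) • v (.inr j) := by
    conv_lhs => rw [← v.sum_repr' (x - W w)]
    rw [Fintype.sum_sum_type, add_eq_right.mpr]
    · simp [inner_sub_right, hz]
    · refine Finset.sum_eq_zero fun i _ => ?_
      rw [inner_sub_right, hy, hw, inner_sum]
      simp [inner_smul_right, inner_gramDual hdet]
  have hnorm : ‖x‖ ^ 2 = ∑ i, inner ℝ (v (.inl i)) x ^ 2 + ∑ j, inner ℝ (v (.inr j)) x ^ 2 := by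
    rw [← v.sum_sq_inner_right x, Fintype.sum_sum_type]
  have hzw : ∑ j ∈ J, inner ℝ (z j) w ^ 2 ≤ (C * ‖x‖) ^ 2 := by
    calc ∑ j ∈ J, inner ℝ (z j) w ^ 2
        = ∑ j ∈ J, (∑ i, inner ℝ (v (.inl i)) x * inner ℝ (z j) (gramDual y i)) ^ 2 := by
          simp [hw, inner_sum, inner_smul_right]
      _ ≤ ∑ j ∈ J, (∑ i, inner ℝ (v (.inl i)) x ^ 2) * ∑ i, inner ℝ (z j) (gramDual y i) ^ 2 :=
          Finset.sum_le_sum fun j _ => Finset.sum_mul_sq_le_sq_mul_sq _ _ _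
      _ = (∑ i, inner ℝ (v (.inl i)) x ^ 2) *
            ∑ i, ∑ j ∈ J, inner ℝ (z j) (gramDual y i) ^ 2 := by
          rw [← Finset.mul_sum, Finset.sum_comm]
      _ ≤ ‖x‖ ^ 2 * C ^ 2 := by
          gcongr
          rw [hnorm]
          exact le_add_of_nonneg_right (by positivity)
      _ = _ := by ring
  have hvx : ∑ j ∈ J, inner ℝ (v (.inr j)) x ^ 2 ≤ ‖x‖ ^ 2 := by
    rw [hnorm]
    refine le_add_of_nonneg_of_le (by positivity) ?_
    exact Finset.sum_le_sum_of_subset_of_nonneg (Finset.subset_univ _) fun _ _ _ => sq_nonneg _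
  have hmink : √(∑ j ∈ J, (inner ℝ (v (.inr j)) x - inner ℝ (z j) w) ^ 2) ≤ (1 + C) * ‖x‖ := by
    apply Real.sqrt_le_iff.mpr ⟨by positivity, ?_⟩
    have hcs : (∑ j ∈ J, inner ℝ (v (.inr j)) x * inner ℝ (z j) w) ^ 2 ≤
        (‖x‖ * (C * ‖x‖)) ^ 2 := by
      rw [mul_pow]
      exact (Finset.sum_mul_sq_le_sq_mul_sq _ _ _).trans
        (mul_le_mul hvx hzw (by positivity) (by positivity))
    have hcs' := neg_le_of_abs_le (abs_le_of_sq_le_sq hcs (by positivity))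
    have hexp : ∑ j ∈ J, (inner ℝ (v (.inr j)) x - inner ℝ (z j) w) ^ 2 =
        ∑ j ∈ J, inner ℝ (v (.inr j)) x ^ 2 - 2 * ∑ j ∈ J, inner ℝ (v (.inr j)) x * inner ℝ (z j) w
          + ∑ j ∈ J, inner ℝ (z j) w ^ 2 := by
      rw [Finset.mul_sum, ← Finset.sum_sub_distrib, ← Finset.sum_add_distrib]
      exact Finset.sum_congr rfl fun j _ => by ring
    rw [hexp]
    linarith
  calc ‖T x - Q (T x)‖ = ‖T (x - W w) - Q (T (x - W w))‖ := by
        rw [map_sub, map_sub, hQT]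
        congr 1
        abel
    _ ≤ ‖T (x - W w)‖ := norm_sub_apply_le_of_isSymmetric hQ hQQ _
    _ ≤ s * ((1 + C) * ‖x‖) := by
        rw [hx]
        exact (hT _).trans (by gcongr)
    _ = _ := by ring

end RangeFinder

section SingularVectors

lemma exists_orthonormalBasis_inner_toEuclideanLin {n m : ℕ} (A : Matrix (Fin n) (Fin m) ℝ)
    (hA : (Aᵀ * A).IsHermitian) {σ : ℕ → ℝ} (e : Fin m ≃ Fin m)
    (he : ∀ i : Fin m, σ (i : ℕ) = √(hA.eigenvalues (e i))) :
    ∃ b : OrthonormalBasis (Fin m) ℝ (EuclideanSpace ℝ (Fin m)), ∀ i j,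
      inner ℝ (toEuclideanLin A (b i)) (toEuclideanLin A (b j)) =
        if i = j then σ (i : ℕ) ^ 2 else 0 := by
  refine ⟨hA.eigenvectorBasis.reindex e.symm, fun i j => ?_⟩
  have hpos : ∀ k, 0 ≤ hA.eigenvalues k :=
    PosSemidef.eigenvalues_nonneg (A := Aᵀ * A) (posSemidef_conjTranspose_mul_self A)
  have hAA : inner ℝ (toEuclideanLin A (hA.eigenvectorBasis (e i)))
      (toEuclideanLin A (hA.eigenvectorBasis (e j))) =
      inner ℝ (hA.eigenvectorBasis (e i)) (hA.eigenvalues (e j) • hA.eigenvectorBasis (e j)) := by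
    rw [← LinearMap.adjoint_inner_right, ← toEuclideanLin_conjTranspose_eq_adjoint]
    congr 1
    ext k
    simpa [toLpLin_apply, mulVec_mulVec, conjTranspose_eq_transpose_of_trivial] using
      congrFun (hA.mulVec_eigenvectorBasis (e j)) k
  simp only [OrthonormalBasis.reindex_apply, Equiv.symm_symm, hAA, inner_smul_right]
  rw [orthonormal_iff_ite.mp hA.eigenvectorBasis.orthonormal]
  by_cases h : i = j
  · simp [h, he, Real.sq_sqrt (hpos _)]
  · simp [h]

lemma eq_zero_of_finrank_le_of_inner_eq {X Y : Type*} [AddCommGroup X] [Module ℝ X]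
    [NormedAddCommGroup Y] [InnerProductSpace ℝ Y] [FiniteDimensional ℝ Y] (T : X →ₗ[ℝ] Y)
    {m : ℕ} {σ : ℕ → ℝ} (hσ : Antitone σ) (hσ0 : ∀ j, 0 ≤ σ j) {b : Fin m → X}
    (hb : ∀ i j, inner ℝ (T (b i)) (T (b j)) = if i = j then σ (i : ℕ) ^ 2 else 0) (i : Fin m)
    (hi : Module.finrank ℝ Y ≤ i) : σ i = 0 := by
  by_contra hne
  have hpos : 0 < σ i := (hσ0 i).lt_of_ne' hne
  let f : Fin (i + 1) → Fin m := Fin.castLE i.isLt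
  have hli : LinearIndependent ℝ fun k => T (b (f k)) := by
    refine linearIndependent_of_ne_zero_of_inner_eq_zero (fun k hk => ?_) fun k l hkl => ?_
    · have h := hb (f k) (f k)
      rw [hk, inner_zero_left, if_pos rfl] at h
      have hk' : σ i ≤ σ (f k) := hσ (Nat.lt_succ_iff.mp k.isLt)
      have := pow_pos (hpos.trans_le hk') 2
      linarith
    · have : f k ≠ f l := fun h => hkl (Fin.castLE_injective _ h)
      simp [hb, this]
  have := hli.fintype_card_le_finrank
  rw [Fintype.card_fin] at this
  omega

end SingularVectors

/-- Simplified randomized SVD estimate: for a real `n × m` matrix `A` with singular values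
`σ 0 ≥ σ 1 ≥ ⋯ ≥ 0` (the decreasingly ordered square roots of the eigenvalues of `AᵀA`,
padded by zeros), `r ≥ 1` with `r + 5 ≤ min{m,n}`, and `Ω` an `m × (r+5)` matrix with
i.i.d. standard Gaussian entries, with probability at least `0.998` the orthogonal
projection `P` onto the column space of `AΩ` satisfies
`‖A − P A‖₂ ≤ (1 + 11 √(min{m,n}(r+5))) σ_{r+1}`.
(Indices are 0-based: `σ r` is the `(r+1)`-st singular value.) -/
theorem randomized_svd_error_bound_simplified (n m r : ℕ) (hr : 1 ≤ r)
    (hk : r + 5 ≤ min m n)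
    (A : Matrix (Fin n) (Fin m) ℝ) (hA : (Aᵀ * A).IsHermitian)
    (σ : ℕ → ℝ) (hσ_anti : Antitone σ) (hσ_pad : ∀ j, m ≤ j → σ j = 0)
    (hσ_eig : ∃ e : Fin m ≃ Fin m, ∀ i : Fin m, σ (i : ℕ) = Real.sqrt (hA.eigenvalues (e i))) :
    ENNReal.ofReal 0.998 ≤
      Measure.pi (fun _ : Fin m × Fin (r + 5) => gaussianReal 0 1)
        {ω | ∀ P : Matrix (Fin n) (Fin n) ℝ,
          P * P = P → Pᵀ = P →
          LinearMap.range (Matrix.toLin' P)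
            = LinearMap.range (Matrix.toLin' (A * Matrix.of fun i j => ω (i, j))) →
          spectralNorm' (A - P * A)
            ≤ (1 + 11 * Real.sqrt ((min m n : ℝ) * ((r : ℝ) + 5))) * σ r} := by
  obtain ⟨m', rfl⟩ : ∃ m', m = r + m' := Nat.exists_eq_add_of_le (by omega)
  obtain ⟨e, he⟩ := hσ_eig
  obtain ⟨b, hb⟩ := exists_orthonormalBasis_inner_toEuclideanLin A hA e he
  have hσ_nonneg : ∀ j, 0 ≤ σ j := fun j =>
    (hσ_pad _ (le_max_right j _)).symm.le.trans (hσ_anti (le_max_left j (r + m')))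
  let v : OrthonormalBasis (Fin r ⊕ Fin m') ℝ (EuclideanSpace ℝ (Fin (r + m'))) :=
    b.reindex finSumFinEquiv.symm
  let J : Finset (Fin m') := {j | r + (j : ℕ) < min (r + m') n}
  have hJ : J.card ≤ min (r + m') n := by
    have h : J.map ⟨fun j : Fin m' => r + (j : ℕ), fun i j h => by simpa [Fin.ext_iff] using h⟩ ⊆
        Finset.range (min (r + m') n) := by
      intro k hk
      obtain ⟨j, hj, rfl⟩ := Finset.mem_map.mp hk
      exact Finset.mem_range.mpr (Finset.mem_filter.mp hj).2
    simpa using Finset.card_le_card h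
  have hT : ∀ a : Fin m' → ℝ, ‖toEuclideanLin A (∑ j, a j • v (.inr j))‖ ≤
      σ r * √(∑ j ∈ J, a j ^ 2) := by
    intro a
    rw [← Real.sqrt_sq (norm_nonneg _), ← Real.sqrt_sq (hσ_nonneg r),
      ← Real.sqrt_mul (sq_nonneg _)]
    apply Real.sqrt_le_sqrt
    have hsum : ‖toEuclideanLin A (∑ j, a j • v (.inr j))‖ ^ 2 =
        ∑ j : Fin m', σ (r + (j : ℕ)) ^ 2 * a j ^ 2 := by
      rw [← real_inner_self_eq_norm_sq, map_sum]
      simp only [map_smul, sum_inner, inner_sum, inner_smul_left, inner_smul_right, v,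
        OrthonormalBasis.reindex_apply, Equiv.symm_symm, finSumFinEquiv_apply_right, hb]
      simp
      exact Finset.sum_congr rfl fun j _ => by ring
    rw [hsum, Finset.mul_sum, ← Finset.sum_subset (Finset.subset_univ J)]
    · gcongr with j
      · exact hσ_nonneg _
      · exact hσ_anti (Nat.le_add_right _ _)
    · intro j _ hj
      have hj' : ¬ r + (j : ℕ) < min (r + m') n := fun h =>
        hj (Finset.mem_filter.mpr ⟨Finset.mem_univ j, h⟩)
      have : σ (r + (j : ℕ)) = 0 := by
        have := eq_zero_of_finrank_le_of_inner_eq (toEuclideanLin A) hσ_anti hσ_nonneg hb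
          (Fin.natAdd r j) (by simp; omega)
        simpa using this
      simp [this]
  let Φ : (Fin (r + m') × Fin (r + 5) → ℝ) →
      (Fin r → EuclideanSpace ℝ (Fin (r + 5))) × (Fin m' → EuclideanSpace ℝ (Fin (r + 5))) :=
    fun ω => (fun i => WithLp.toLp 2 fun l => ∑ k, v (.inl i) k * ω (k, l),
      fun j => WithLp.toLp 2 fun l => ∑ k, v (.inr j) k * ω (k, l))
  have : SigmaFinite (stdGaussian (EuclideanSpace ℝ (Fin (r + 5)))) := inferInstance
  have hΦ : MeasurePreserving Φ (Measure.pi fun _ => gaussianReal 0 1)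
      ((Measure.pi fun _ => stdGaussian _).prod (Measure.pi fun _ => stdGaussian _)) :=
    (measurePreserving_sumPiEquivProdPi
      (fun _ : Fin r ⊕ Fin m' => stdGaussian (EuclideanSpace ℝ (Fin (r + 5))))).comp
      ⟨by fun_prop, gaussian_map_orthonormalBasis_rows v⟩
  let G := {p : (Fin r → EuclideanSpace ℝ (Fin (r + 5))) ×
      (Fin m' → EuclideanSpace ℝ (Fin (r + 5))) |
    (gram ℝ p.1).det ≠ 0 ∧ ∑ i, ∑ j ∈ J, inner ℝ (p.2 j) (gramDual p.1 i) ^ 2 ≤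
      120 * (min (r + m') n : ℕ) * r}
  have hG : ENNReal.ofReal 0.998 ≤ (Measure.pi fun _ => gaussianReal 0 1) (Φ ⁻¹' G) := by
    have hbad := (Measure.le_map_apply hΦ.aemeasurable Gᶜ).trans <| hΦ.map_eq ▸
      prod_pi_stdGaussian_exceptional_le hr (by simp) hk hJ
    have h1 := measure_univ_le_add_compl (μ := Measure.pi fun _ => gaussianReal 0 1) (Φ ⁻¹' G)
    rw [measure_univ] at h1
    have h2 : ENNReal.ofReal 0.998 + ENNReal.ofReal 0.002 = 1 := by
      rw [← ENNReal.ofReal_add (by norm_num) (by norm_num)]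
      norm_num
    rw [← h2] at h1
    exact (ENNReal.add_le_add_iff_right ENNReal.ofReal_ne_top).mp
      (h1.trans (add_le_add_right hbad _))
  refine hG.trans (measure_mono ?_)
  rintro ω ⟨hdet, hsum⟩ P hPP hPt hrange
  set Ω : Matrix (Fin (r + m')) (Fin (r + 5)) ℝ := Matrix.of fun i j => ω (i, j) with hΩ
  have hinner : ∀ (u : EuclideanSpace ℝ (Fin (r + m'))) (w : EuclideanSpace ℝ (Fin (r + 5))),
      inner ℝ u (toEuclideanLin Ω w) =
        inner ℝ (WithLp.toLp 2 fun l => ∑ k, u k * ω (k, l) : EuclideanSpace ℝ (Fin (r + 5))) w := by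
    intro u w
    simp only [PiLp.inner_apply, toLpLin_apply, mulVec, dotProduct, hΩ, of_apply, RCLike.inner_apply,
      conj_trivial, Finset.sum_mul, Finset.mul_sum]
    rw [Finset.sum_comm]
    exact Finset.sum_congr rfl fun _ _ => Finset.sum_congr rfl fun _ _ => by ring
  refine ContinuousLinearMap.opNorm_le_bound _
    (mul_nonneg (by positivity) (hσ_nonneg r)) fun x => ?_
  have key := norm_sub_projection_le v (toEuclideanLin A) (toEuclideanLin Ω) (toEuclideanLin P)
    (isSymmetric_toEuclideanLin_iff.mpr hPt)
    (fun u => by simp [toLpLin_apply, hPP]) (fun w => ?_) (fun i w => hinner (v (.inl i)) w)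
    (fun j w => hinner (v (.inr j)) w) hdet (hσ_nonneg r)
    (C := 11 * √((min (r + m' : ℕ) n : ℝ) * ((r : ℝ) + 5))) (by positivity) hT ?_ x
  · simpa [map_sub] using key
  · obtain ⟨u, hu⟩ : toLin' (A * Ω) w.ofLp ∈ LinearMap.range (toLin' P) :=
      hrange ▸ LinearMap.mem_range_self _ _
    rw [toLin'_apply, toLin'_apply] at hu
    simp only [toLpLin_apply, mulVec_mulVec]
    rw [← hu, ← mulVec_mulVec, ← hu, mulVec_mulVec, hPP]
  · refine hsum.trans ?_
    rw [mul_pow, Real.sq_sqrt (by positivity), Nat.cast_min]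
    have : (0 : ℝ) ≤ min ((r + m' : ℕ) : ℝ) n := by positivity
    nlinarith
end
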